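/- Let Q = Q(n,t_1,…,t_n) be the linear quiver with vertices 0,1,…,n, one loop ε_i at each vertex i, and for each 1 ≤ i ≤ n arrows α_{1i},…,α_{t_i i} from vertex i to vertex i−1 (with n ≥ 1 and all t_i ≥ 1). Let A = KQ/I with I an admissible ideal, assume A is geometrically irreducible, set A_i := e_iAe_i (a truncated polynomial ring), B_i := e_{i−1}Ae_i, and let r_i be the rank of B_i as a free left A_{i−1}-module. Let A' := KQ/I', where I' is the ideal generated by all relations ρ ∈ I of degree at most one with respect to the grading deg(ε_i) = 0, deg(α_{ji}) = 1. Then for every vertex i, the projective A'-module A'e_i is locally free with rank vector (r_1⋯r_i, r_2⋯r_i, …, r_i, 1, 0, …, 0); that is, for 0 ≤ j ≤ i the A_j-module e_jA'e_i is free of rank r_{j+1}⋯r_i (rank 1 for j = i), and e_jA'e_i = 0 for j > i. -/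

import Mathlib

open scoped BigOperators

noncomputable section
/-! ## Quivers and paths -/

/-- A finite quiver: finite sets of vertices and arrows together with source and
target maps. -/
structure FinQuiver : Type 1 where
  V : Type
  A : Type
  [fintypeV : Fintype V]
  [fintypeA : Fintype A]
  [decEqV : DecidableEq V]
  [decEqA : DecidableEq A]
  src : A → V
  tgt : A → V

attribute [instance] FinQuiver.fintypeV FinQuiver.fintypeA FinQuiver.decEqV FinQuiver.decEqA

/-- A path of positive length in a quiver: a list of composable arrows `[a₁, …, aₘ]`
satisfying `s (aᵢ) = t (aᵢ₊₁)`. -/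
structure QPath (Q : FinQuiver) : Type where
  arrows : List Q.A
  ne : arrows ≠ []
  chain : arrows.Chain' fun a b => Q.src a = Q.tgt b

namespace QPath

variable {Q : FinQuiver}

/-- The length of a path. -/
def length (p : QPath Q) : ℕ := p.arrows.length

/-- The target `t (a₁)` of a path `(a₁, …, aₘ)`. -/
def tgt (p : QPath Q) : Q.V := Q.tgt (p.arrows.head p.ne)

/-- The source `s (aₘ)` of a path `(a₁, …, aₘ)`. -/
def src (p : QPath Q) : Q.V := Q.src (p.arrows.getLast p.ne)

/-- A path is a cycle if its source equals its target. -/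
def IsCycle (p : QPath Q) : Prop := p.src = p.tgt

/-- A cycle `(a₁, …, aₘ)` is primitive if the vertices `s (a₁), …, s (aₘ)` are pairwise
different. -/
def IsPrimitive (p : QPath Q) : Prop := (p.arrows.map Q.src).Nodup

end QPath

/-! ## The path algebra, relations, admissible ideals and representation varieties -/

/-- The defining relations presenting the path algebra `KQ` as a quotient of the free
algebra on the vertices and arrows of `Q`: the vertices become a complete set of
orthogonal idempotents summing to `1`, and `e_{t(a)} * a = a = a * e_{s(a)}` for every
arrow `a`. -/
inductive PathRel (K : Type) [Field K] (Q : FinQuiver) :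
    FreeAlgebra K (Q.V ⊕ Q.A) → FreeAlgebra K (Q.V ⊕ Q.A) → Prop
  | idem (i : Q.V) : PathRel K Q
      (FreeAlgebra.ι K (Sum.inl i) * FreeAlgebra.ι K (Sum.inl i)) (FreeAlgebra.ι K (Sum.inl i))
  | orth (i j : Q.V) (h : i ≠ j) : PathRel K Q
      (FreeAlgebra.ι K (Sum.inl i) * FreeAlgebra.ι K (Sum.inl j)) 0
  | sum_one : PathRel K Q (∑ i : Q.V, FreeAlgebra.ι K (Sum.inl i)) 1
  | tgt_mul (a : Q.A) : PathRel K Q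
      (FreeAlgebra.ι K (Sum.inl (Q.tgt a)) * FreeAlgebra.ι K (Sum.inr a))
      (FreeAlgebra.ι K (Sum.inr a))
  | mul_src (a : Q.A) : PathRel K Q
      (FreeAlgebra.ι K (Sum.inr a) * FreeAlgebra.ι K (Sum.inl (Q.src a)))
      (FreeAlgebra.ι K (Sum.inr a))

/-- The path algebra `KQ`. -/
abbrev PathAlgebra (K : Type) [Field K] (Q : FinQuiver) : Type := RingQuot (PathRel K Q)

variable (K : Type) [Field K] (Q : FinQuiver)

/-- The idempotent `eᵢ ∈ KQ` corresponding to a vertex `i` (the path of length zero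
at `i`). -/
def vertexElem (i : Q.V) : PathAlgebra K Q :=
  RingQuot.mkAlgHom K (PathRel K Q) (FreeAlgebra.ι K (Sum.inl i))

/-- The element of `KQ` corresponding to an arrow `a`. -/
def arrowElem (a : Q.A) : PathAlgebra K Q :=
  RingQuot.mkAlgHom K (PathRel K Q) (FreeAlgebra.ι K (Sum.inr a))

/-- The element of `KQ` corresponding to a path `(a₁, …, aₘ)`, namely `a₁ ⋯ aₘ`. -/
def pathElem (p : QPath Q) : PathAlgebra K Q := (p.arrows.map (arrowElem K Q)).prod

/-- The element `∑ₚ c p • p` of `KQ` determined by a finitely supported family of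
coefficients on paths. -/
def relElem (c : QPath Q →₀ K) : PathAlgebra K Q := c.sum fun p l => l • pathElem K Q p

/-- `c` is the datum of a relation with common target `i` and common source `j`: all
paths in its support have length at least two, target `i` and source `j`.  (The paths in
the support are pairwise different and have nonzero coefficients by definition of a
finitely supported function.) -/
def IsRelationData (c : QPath Q →₀ K) (i j : Q.V) : Prop :=
  ∀ p ∈ c.support, 2 ≤ p.length ∧ p.tgt = i ∧ p.src = j

/-- An element of `KQ` is a relation if it is a `K`-linear combination `∑ λₚ • p` of
pairwise different paths of length at least two having a common source and a common
target, with all `λₚ ≠ 0`. -/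
def IsRelation (x : PathAlgebra K Q) : Prop :=
  ∃ (c : QPath Q →₀ K) (i j : Q.V), IsRelationData K Q c i j ∧ x = relElem K Q c

/-- The two-sided ideal generated by a set `S`, as a set: the additive subgroup generated
by all elements `a * s * b` with `s ∈ S`. -/
def twoSidedSpan (R : Type) [Ring R] (S : Set R) : Set R :=
  (AddSubgroup.closure {x | ∃ a b : R, ∃ s ∈ S, x = a * s * b} : AddSubgroup R)

/-- `φ : KQ →ₐ[K] A` presents `A` as `KQ/I` with `I = ker φ` an admissible ideal:
`φ` is surjective, its kernel is generated (as a two-sided ideal) by a set of relations,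
and there is some `m ≥ 2` such that all paths of length at least `m` lie in the kernel. -/
def IsAdmissiblePresentation {A : Type} [Ring A] [Algebra K A]
    (φ : PathAlgebra K Q →ₐ[K] A) : Prop :=
  Function.Surjective φ ∧
  (∃ S : Set (PathAlgebra K Q), (∀ x ∈ S, IsRelation K Q x) ∧
    twoSidedSpan (PathAlgebra K Q) S = {x | φ x = 0}) ∧
  ∃ m : ℕ, 2 ≤ m ∧ ∀ p : QPath Q, m ≤ p.length → φ (pathElem K Q p) = 0

/-- The index type for the rows/columns of the matrices in a `d`-dimensional
representation: the basis vectors of `⊕ᵢ K^{dᵢ}`. -/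
abbrev RepIx (d : Q.V → ℕ) : Type := (i : Q.V) × Fin (d i)

/-- The ambient affine space of `d`-dimensional representations.  An arrow `a` gets a
matrix; membership in `RepSet` forces the matrix of `a` to be concentrated in the block
with rows indexed by the block `t(a)` and columns indexed by the block `s(a)`, i.e. to be
(the block extension of) a `d (t a) × d (s a)`-matrix. -/
abbrev RepSpace (d : Q.V → ℕ) : Type := Q.A → Matrix (RepIx Q d) (RepIx Q d) K

/-- The Zariski topology on affine space `K^ι`: generated by the complements of zero sets
of polynomials in the coordinates. -/
def zariskiTopology (ι R : Type) [CommSemiring R] : TopologicalSpace (ι → R) :=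
  TopologicalSpace.generateFrom
    {U | ∃ f : MvPolynomial ι R, U = {x | MvPolynomial.eval x f ≠ 0}}

/-- The Zariski topology on the ambient space of `d`-dimensional representations. -/
def repTopology (d : Q.V → ℕ) : TopologicalSpace (RepSpace K Q d) :=
  TopologicalSpace.induced (fun M (x : Q.A × RepIx Q d × RepIx Q d) => M x.1 x.2.1 x.2.2)
    (zariskiTopology (Q.A × RepIx Q d × RepIx Q d) K)

/-- The condition that the matrix of each arrow `a` is concentrated in the
`(t a, s a)`-block, i.e. really is a `d (t a) × d (s a)`-matrix. -/
def BlockCompatible (d : Q.V → ℕ) (M : RepSpace K Q d) : Prop :=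
  ∀ (a : Q.A) (u v : RepIx Q d), M a u v ≠ 0 → u.1 = Q.tgt a ∧ v.1 = Q.src a

/-- The evaluation `M(p) = M(a₁) ⋯ M(aₘ)` of a representation at a path. -/
def pathProd (d : Q.V → ℕ) (M : RepSpace K Q d) (p : QPath Q) :
    Matrix (RepIx Q d) (RepIx Q d) K := (p.arrows.map M).prod

/-- The evaluation `M(ρ) = ∑ λₚ M(p)` of a representation at a linear combination of
paths. -/
def relEval (d : Q.V → ℕ) (M : RepSpace K Q d) (c : QPath Q →₀ K) :
    Matrix (RepIx Q d) (RepIx Q d) K := c.sum fun p l => l • pathProd K Q d M p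

/-- The affine variety `rep(A, d)` of `d`-dimensional representations of `A = KQ/I`,
where `I = ker φ`: tuples of matrices (of the correct block sizes) with `M(ρ) = 0` for
every relation `ρ ∈ I`. -/
def RepSet {A : Type} [Ring A] [Algebra K A] (φ : PathAlgebra K Q →ₐ[K] A) (d : Q.V → ℕ) :
    Set (RepSpace K Q d) :=
  {M | BlockCompatible K Q d M ∧
    ∀ (c : QPath Q →₀ K) (i j : Q.V), IsRelationData K Q c i j →
      φ (relElem K Q c) = 0 → relEval K Q d M c = 0}

/-- `A = KQ/I` (presented by `φ`, with `I = ker φ`) is geometrically irreducible if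
`rep(A, d)` is an irreducible topological space for every dimension vector `d`. -/
def IsGeomIrreducible {A : Type} [Ring A] [Algebra K A] (φ : PathAlgebra K Q →ₐ[K] A) :
    Prop :=
  ∀ d : Q.V → ℕ, @IsIrreducible _ (repTopology K Q d) (RepSet K Q φ d)

/-! ## Corner rings `eAe` and local freeness -/

/-- An idempotent element of a ring. -/
structure IdemElem (A : Type) [Ring A] : Type where
  e : A
  idem : e * e = e

/-- The corner ring `eAe` of an idempotent `e`. -/
def Corner {A : Type} [Ring A] (ε : IdemElem A) : Type :=
  {x : A // ε.e * x = x ∧ x * ε.e = x}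

namespace Corner

variable {A : Type} [Ring A] {ε : IdemElem A}

instance : Zero (Corner ε) := ⟨⟨0, by simp⟩⟩
instance : Add (Corner ε) :=
  ⟨fun x y => ⟨x.1 + y.1, by rw [mul_add, x.2.1, y.2.1], by rw [add_mul, x.2.2, y.2.2]⟩⟩
instance : Neg (Corner ε) :=
  ⟨fun x => ⟨-x.1, by rw [mul_neg, x.2.1], by rw [neg_mul, x.2.2]⟩⟩
instance : One (Corner ε) := ⟨⟨ε.e, ε.idem, ε.idem⟩⟩
instance : Mul (Corner ε) :=
  ⟨fun x y => ⟨x.1 * y.1, by rw [← mul_assoc, x.2.1], by rw [mul_assoc, y.2.2]⟩⟩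

instance instRing : Ring (Corner ε) where
  add_assoc x y z := Subtype.ext (add_assoc _ _ _)
  zero_add x := Subtype.ext (zero_add _)
  add_zero x := Subtype.ext (add_zero _)
  add_comm x y := Subtype.ext (add_comm _ _)
  neg_add_cancel x := Subtype.ext (neg_add_cancel _)
  mul_assoc x y z := Subtype.ext (mul_assoc _ _ _)
  one_mul x := Subtype.ext x.2.1
  mul_one x := Subtype.ext x.2.2
  left_distrib x y z := Subtype.ext (left_distrib _ _ _)
  right_distrib x y z := Subtype.ext (right_distrib _ _ _)
  zero_mul x := Subtype.ext (zero_mul _)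
  mul_zero x := Subtype.ext (mul_zero _)
  nsmul := nsmulRec
  zsmul := zsmulRec

end Corner

/-- The subgroup `eM` of an `A`-module `M`, as a module over the corner ring `eAe`. -/
def CornerMod {A : Type} [Ring A] (ε : IdemElem A) (M : Type) [AddCommGroup M]
    [Module A M] : Type :=
  {m : M // ε.e • m = m}

namespace CornerMod

variable {A : Type} [Ring A] {ε : IdemElem A} {M : Type} [AddCommGroup M] [Module A M]

instance : Zero (CornerMod ε M) := ⟨⟨0, smul_zero _⟩⟩
instance : Add (CornerMod ε M) := ⟨fun x y => ⟨x.1 + y.1, by rw [smul_add, x.2, y.2]⟩⟩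
instance : Neg (CornerMod ε M) := ⟨fun x => ⟨-x.1, by rw [smul_neg, x.2]⟩⟩

instance instAddCommGroup : AddCommGroup (CornerMod ε M) where
  add_assoc x y z := Subtype.ext (add_assoc _ _ _)
  zero_add x := Subtype.ext (zero_add _)
  add_zero x := Subtype.ext (add_zero _)
  add_comm x y := Subtype.ext (add_comm _ _)
  neg_add_cancel x := Subtype.ext (neg_add_cancel _)
  nsmul := nsmulRec
  zsmul := zsmulRec

instance instSMul : SMul (Corner ε) (CornerMod ε M) :=
  ⟨fun c m => ⟨c.1 • m.1, by rw [smul_smul, c.2.1]⟩⟩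

theorem val_smul (c : Corner ε) (m : CornerMod ε M) : (c • m).1 = c.1 • m.1 := rfl
theorem val_zero : (0 : CornerMod ε M).1 = 0 := rfl
theorem val_add (m n : CornerMod ε M) : (m + n).1 = m.1 + n.1 := rfl

instance instModule : Module (Corner ε) (CornerMod ε M) where
  one_smul m := Subtype.ext (by rw [val_smul]; exact m.2)
  mul_smul c d m := Subtype.ext (by simp only [val_smul]; exact mul_smul c.1 d.1 m.1)
  smul_zero c := Subtype.ext (by simp only [val_smul, val_zero]; exact smul_zero c.1)
  smul_add c m n := Subtype.ext
    (by simp only [val_smul, val_add]; exact smul_add c.1 m.1 n.1)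
  add_smul c d m := Subtype.ext
    (by simp only [val_smul, val_add]; exact add_smul c.1 d.1 m.1)
  zero_smul m := Subtype.ext (by simp only [val_smul, val_zero]; exact zero_smul A m.1)

end CornerMod

theorem vertexElem_mul_self (i : Q.V) :
    vertexElem K Q i * vertexElem K Q i = vertexElem K Q i := by
  rw [vertexElem, ← map_mul]
  exact RingQuot.mkAlgHom_rel K (PathRel.idem i)

/-- The idempotent `eᵢ ∈ A = KQ/I` corresponding to a vertex `i`. -/
def vertexIdem {A : Type} [Ring A] [Algebra K A] (φ : PathAlgebra K Q →ₐ[K] A)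
    (i : Q.V) : IdemElem A :=
  ⟨φ (vertexElem K Q i), by rw [← map_mul, vertexElem_mul_self]⟩

/-- An `A = KQ/I`-module `M` is locally free if `eᵢM` is a free `eᵢAeᵢ`-module for
every vertex `i`. -/
def IsLocallyFree {A : Type} [Ring A] [Algebra K A] (φ : PathAlgebra K Q →ₐ[K] A)
    (M : Type) [AddCommGroup M] [Module A M] : Prop :=
  ∀ i : Q.V,
    Module.Free (Corner (vertexIdem K Q φ i)) (CornerMod (vertexIdem K Q φ i) M)

/-! ## The bimodule pieces `eAf` -/

/-- The subgroup `eAf = {x : A | e * x = x ∧ x * f = x}` of `A`, as a module over the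
corner ring `eAe` (acting by left multiplication). -/
def CornerPiece {A : Type} [Ring A] (ε : IdemElem A) (f : A) : Type :=
  {x : A // ε.e * x = x ∧ x * f = x}

namespace CornerPiece

variable {A : Type} [Ring A] {ε : IdemElem A} {f : A}

instance : Zero (CornerPiece ε f) := ⟨⟨0, by simp⟩⟩
instance : Add (CornerPiece ε f) :=
  ⟨fun x y => ⟨x.1 + y.1, by rw [mul_add, x.2.1, y.2.1], by rw [add_mul, x.2.2, y.2.2]⟩⟩
instance : Neg (CornerPiece ε f) :=
  ⟨fun x => ⟨-x.1, by rw [mul_neg, x.2.1], by rw [neg_mul, x.2.2]⟩⟩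

instance instAddCommGroup : AddCommGroup (CornerPiece ε f) where
  add_assoc x y z := Subtype.ext (add_assoc _ _ _)
  zero_add x := Subtype.ext (zero_add _)
  add_zero x := Subtype.ext (add_zero _)
  add_comm x y := Subtype.ext (add_comm _ _)
  neg_add_cancel x := Subtype.ext (neg_add_cancel _)
  nsmul := nsmulRec
  zsmul := zsmulRec

instance instSMul : SMul (Corner ε) (CornerPiece ε f) :=
  ⟨fun c x => ⟨c.1 * x.1, by rw [← mul_assoc, c.2.1], by rw [mul_assoc, x.2.2]⟩⟩

theorem val_smul (c : Corner ε) (x : CornerPiece ε f) : (c • x).1 = c.1 * x.1 := rfl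
theorem val_zero : (0 : CornerPiece ε f).1 = 0 := rfl
theorem val_add (x y : CornerPiece ε f) : (x + y).1 = x.1 + y.1 := rfl

instance instModule : Module (Corner ε) (CornerPiece ε f) where
  one_smul x := Subtype.ext (by rw [val_smul]; exact x.2.1)
  mul_smul c d x := Subtype.ext (by simp only [val_smul]; exact mul_assoc c.1 d.1 x.1)
  smul_zero c := Subtype.ext (by simp only [val_smul, val_zero]; exact mul_zero c.1)
  smul_add c x y := Subtype.ext
    (by simp only [val_smul, val_add]; exact mul_add c.1 x.1 y.1)
  add_smul c d x := Subtype.ext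
    (by simp only [val_smul, val_add]; exact add_mul c.1 d.1 x.1)
  zero_smul x := Subtype.ext (by simp only [val_smul, val_zero]; exact zero_mul x.1)

end CornerPiece

/-! ## The linear quivers `Q(n, t₁, …, tₙ)` and the degree grading -/

/-- The linear quiver `Q(n, t₁, …, tₙ)`: vertices `0, 1, …, n`, one loop `εᵢ` at each
vertex `i` (the arrows `Sum.inl i`), and for each `1 ≤ i ≤ n` the arrows
`α_{1i}, …, α_{tᵢi}` from vertex `i` to vertex `i - 1` (the arrows `Sum.inr ⟨i-1, j⟩`). -/
def LinearQuiver (n : ℕ) (t : Fin n → ℕ) : FinQuiver where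
  V := Fin (n + 1)
  A := Fin (n + 1) ⊕ ((i : Fin n) × Fin (t i))
  src := Sum.elim id fun x => x.1.succ
  tgt := Sum.elim id fun x => x.1.castSucc

/-- The degree of a path in the linear quiver, for the grading with `deg εᵢ = 0` and
`deg α_{ji} = 1`: the number of non-loop arrows occurring in the path. -/
def pathDegree {n : ℕ} {t : Fin n → ℕ} (p : QPath (LinearQuiver n t)) : ℕ :=
  p.arrows.countP fun a => a.isRight

/-- A relation for the linear quiver all of whose paths have degree at most one. -/
def IsDegreeLeOneRelation {n : ℕ} {t : Fin n → ℕ} (x : PathAlgebra K (LinearQuiver n t)) :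
    Prop :=
  ∃ (c : QPath (LinearQuiver n t) →₀ K) (i j : Fin (n + 1)),
    IsRelationData K (LinearQuiver n t) c i j ∧ (∀ p ∈ c.support, pathDegree p ≤ 1) ∧
    x = relElem K (LinearQuiver n t) c

/-- A relation for the linear quiver all of whose paths have degree exactly one. -/
def IsDegreeOneRelation {n : ℕ} {t : Fin n → ℕ} (x : PathAlgebra K (LinearQuiver n t)) :
    Prop :=
  ∃ (c : QPath (LinearQuiver n t) →₀ K) (i j : Fin (n + 1)),
    IsRelationData K (LinearQuiver n t) c i j ∧ (∀ p ∈ c.support, pathDegree p = 1) ∧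
    x = relElem K (LinearQuiver n t) c

/-! ## Peirce pieces of an algebra with a complete set of orthogonal idempotents -/

section Peirce

variable {K} {ι R : Type} [Ring R] [Algebra K R]

variable (K) in
/-- The Peirce component `e_j R e_i`, as a subspace of `R`. -/
def peirceSpace (e : ι → R) (j i : ι) : Submodule K R where
  carrier := {x | e j * x = x ∧ x * e i = x}
  add_mem' := by
    rintro x y ⟨hx, hx'⟩ ⟨hy, hy'⟩
    exact ⟨by rw [mul_add, hx, hy], by rw [add_mul, hx', hy']⟩
  zero_mem' := ⟨mul_zero _, zero_mul _⟩
  smul_mem' := by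
    rintro a x ⟨hx, hx'⟩
    exact ⟨by rw [mul_smul_comm, hx], by rw [smul_mul_assoc, hx']⟩

theorem mul_mem_peirceSpace {e : ι → R} {j k m i : ι} {x y : R} (hx : x ∈ peirceSpace K e j k)
    (hy : y ∈ peirceSpace K e m i) : x * y ∈ peirceSpace K e j i :=
  ⟨by rw [← mul_assoc, hx.1], by rw [mul_assoc, hy.2]⟩

theorem corner_eq_of_mem {e : ι → R} {j i : ι} {x : R} (hx : x ∈ peirceSpace K e j i) :
    e j * x * e i = x := by rw [hx.1, hx.2]

variable [Fintype ι] {e : ι → R}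

theorem corner_mem_peirceSpace (he : CompleteOrthogonalIdempotents e) (j i : ι) (x : R) :
    e j * x * e i ∈ peirceSpace K e j i :=
  ⟨by rw [← mul_assoc, ← mul_assoc, (he.idem j).eq], by rw [mul_assoc, (he.idem i).eq]⟩

theorem idem_mem_peirceSpace (he : CompleteOrthogonalIdempotents e) (i : ι) :
    e i ∈ peirceSpace K e i i := ⟨(he.idem i).eq, (he.idem i).eq⟩

theorem idem_mul_eq_zero (he : CompleteOrthogonalIdempotents e) {j k i : ι} {x : R}
    (hx : x ∈ peirceSpace K e k i) (h : j ≠ k) : e j * x = 0 := by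
  rw [← hx.1, ← mul_assoc, he.ortho h, zero_mul]

theorem mul_idem_eq_zero (he : CompleteOrthogonalIdempotents e) {j k i : ι} {x : R}
    (hx : x ∈ peirceSpace K e j k) (h : k ≠ i) : x * e i = 0 := by
  rw [← hx.2, mul_assoc, he.ortho h, mul_zero]

theorem peirceSpace_mul_eq_zero (he : CompleteOrthogonalIdempotents e) {j k m i : ι} {x y : R}
    (hx : x ∈ peirceSpace K e j k) (hy : y ∈ peirceSpace K e m i) (h : k ≠ m) : x * y = 0 := by
  rw [← hx.2, mul_assoc, idem_mul_eq_zero he hy h, mul_zero]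

theorem mul_eq_sum_idem (he : CompleteOrthogonalIdempotents e) (x y : R) :
    x * y = ∑ m, x * e m * y := by
  rw [← Finset.sum_mul, ← Finset.mul_sum, he.complete, mul_one]

end Peirce

section Linear

variable {K} {n : ℕ} {R : Type} [Ring R] [Algebra K R] {e : Fin (n + 1) → R}

variable (K) in
/-- `x` lies in a Peirce component `e_k R e_k` or `e_k R e_{k+1}`. -/
def IsLocal (e : Fin (n + 1) → R) (x : R) : Prop :=
  (∃ k, x ∈ peirceSpace K e k k) ∨ ∃ k : Fin n, x ∈ peirceSpace K e k.castSucc k.succ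

theorem corner_eq_zero_of_lt (he : CompleteOrthogonalIdempotents e)
    (hgen : Algebra.adjoin K {x | IsLocal K e x} = ⊤) {i j : Fin (n + 1)} (hij : i < j) (x : R) :
    e j * x * e i = 0 := by
  have hx : x ∈ Algebra.adjoin K {x | IsLocal K e x} := by rw [hgen]; trivial
  induction hx using Algebra.adjoin_induction generalizing i j with
  | mem x hx =>
    rcases hx with ⟨k, hk⟩ | ⟨k, hk⟩
    · by_cases h : j = k
      · rw [mul_assoc, mul_idem_eq_zero he hk (by rintro rfl; omega), mul_zero]
      · rw [idem_mul_eq_zero he hk h, zero_mul]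
    · by_cases h : j = k.castSucc
      · rw [mul_assoc, mul_idem_eq_zero he hk, mul_zero]
        rintro rfl
        subst h
        exact absurd hij (by simp [Fin.lt_def])
      · rw [idem_mul_eq_zero he hk h, zero_mul]
  | algebraMap a =>
    rw [← Algebra.commutes, mul_assoc, he.ortho hij.ne', mul_zero]
  | add x y _ _ hx hy => rw [mul_add, add_mul, hx hij, hy hij, add_zero]
  | mul x y _ _ hx hy =>
    rw [← mul_assoc, mul_eq_sum_idem he (e j * x) y, Finset.sum_mul]
    refine Finset.sum_eq_zero fun m _ => ?_
    rcases lt_or_ge m j with h | h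
    · rw [hx h, zero_mul, zero_mul]
    · rw [mul_assoc (e j * x), mul_assoc (e j * x), ← mul_assoc, mul_assoc (e j * x),
        hy (hij.trans_le h), mul_zero]

theorem corner_mul_self (he : CompleteOrthogonalIdempotents e)
    (hgen : Algebra.adjoin K {x | IsLocal K e x} = ⊤) (k : Fin (n + 1)) (x y : R) :
    e k * (x * y) * e k = (e k * x * e k) * (e k * y * e k) := by
  rw [← mul_assoc, mul_eq_sum_idem he (e k * x) y, Finset.sum_mul,
    Finset.sum_eq_single k]
  · simp only [mul_assoc]
    rw [← mul_assoc (e k) (e k), (he.idem k).eq]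
  · intro m _ hm
    rcases hm.lt_or_gt with h | h
    · rw [corner_eq_zero_of_lt he hgen h, zero_mul, zero_mul]
    · rw [mul_assoc, mul_assoc, ← mul_assoc (e m), corner_eq_zero_of_lt he hgen h, mul_zero]
  · simp

theorem corner_mul_succ (he : CompleteOrthogonalIdempotents e)
    (hgen : Algebra.adjoin K {x | IsLocal K e x} = ⊤) (k : Fin n) (x y : R) :
    e k.castSucc * (x * y) * e k.succ =
      (e k.castSucc * x * e k.castSucc) * (e k.castSucc * y * e k.succ) +
      (e k.castSucc * x * e k.succ) * (e k.succ * y * e k.succ) := by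
  have hne : k.castSucc ≠ k.succ := (Fin.castSucc_lt_succ).ne
  rw [← mul_assoc, mul_eq_sum_idem he (e k.castSucc * x) y, Finset.sum_mul,
    Finset.sum_eq_add k.castSucc k.succ hne]
  · simp only [mul_assoc]
    rw [← mul_assoc (e k.castSucc) (e k.castSucc), (he.idem k.castSucc).eq,
      ← mul_assoc (e k.succ) (e k.succ), (he.idem k.succ).eq]
  · intro m _ hm
    rcases lt_or_ge m k.castSucc with h | h
    · rw [corner_eq_zero_of_lt he hgen h, zero_mul, zero_mul]
    · have h' : k.succ < m := by
        have h1 := hm.1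
        have h2 := hm.2
        simp only [Fin.lt_def, Fin.le_def, ne_eq, Fin.ext_iff, Fin.val_castSucc,
          Fin.val_succ] at *
        omega
      rw [mul_assoc, mul_assoc, ← mul_assoc (e m), corner_eq_zero_of_lt he hgen h', mul_zero]
  · simp
  · simp

end Linear

/-! ## Coordinates on the degree one pieces -/

/-- The letters `(k, l)` indexing the basis elements of the modules `e_k R e_{k+1}`. -/
abbrev Letter (n : ℕ) (r : Fin n → ℕ) : Type := (k : Fin n) × Fin (r k)

variable {K} in
/-- A choice of bases `b (k, ·)` of the left `e_k R e_k`-modules `e_k R e_{k+1}`, together with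
the coordinate functions `c (k, ·)`, extended by zero to `R` along the Peirce decomposition. -/
structure PeirceCoordinates {n : ℕ} (r : Fin n → ℕ) {R : Type} [Ring R] [Algebra K R]
    (e : Fin (n + 1) → R) where
  b : Letter n r → R
  c : Letter n r → R →ₗ[K] R
  b_mem : ∀ l, b l ∈ peirceSpace K e l.1.castSucc l.1.succ
  c_mem : ∀ l y, c l y ∈ peirceSpace K e l.1.castSucc l.1.castSucc
  c_mul : ∀ l, ∀ a ∈ peirceSpace K e l.1.castSucc l.1.castSucc, ∀ y, c l (a * y) = a * c l y
  c_proj : ∀ l y, c l (e l.1.castSucc * y * e l.1.succ) = c l y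
  expand : ∀ k : Fin n, ∀ y ∈ peirceSpace K e k.castSucc k.succ,
    y = ∑ l : Fin (r k), c ⟨k, l⟩ y * b ⟨k, l⟩
  c_b : ∀ (k : Fin n) (l l' : Fin (r k)),
    c ⟨k, l⟩ (b ⟨k, l'⟩) = if l = l' then e k.castSucc else 0

namespace PeirceCoordinates

variable {K} {n : ℕ} {r : Fin n → ℕ} {R : Type} [Ring R] [Algebra K R] {e : Fin (n + 1) → R}
  (B : PeirceCoordinates (K := K) r e)

theorem c_mul_of_mem (he : CompleteOrthogonalIdempotents e) (l : Letter n r) {k : Fin (n + 1)}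
    {a : R} (ha : a ∈ peirceSpace K e k k) (y : R) : B.c l (a * y) = a * B.c l y := by
  by_cases h : l.1.castSucc = k
  · subst h
    exact B.c_mul l a ha y
  · rw [peirceSpace_mul_eq_zero he ha (B.c_mem l y) (Ne.symm h), ← B.c_proj, ← mul_assoc,
      idem_mul_eq_zero he ha h, zero_mul, zero_mul, map_zero]

theorem c_b_eq (he : CompleteOrthogonalIdempotents e) (l l' : Letter n r) :
    B.c l (B.b l') = if l = l' then e l'.1.castSucc else 0 := by
  obtain ⟨k, l⟩ := l
  obtain ⟨k', l'⟩ := l'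
  by_cases h : k = k'
  · subst h
    simp [B.c_b]
  · rw [if_neg (by rintro ⟨⟩; exact h rfl), ← B.c_proj, idem_mul_eq_zero he (B.b_mem ⟨k', l'⟩),
      zero_mul, map_zero]
    simpa using h

/-- The operator on functions on words that reads off the coordinates in front of the first
letter. -/
def shift : Module.End K (List (Letter n r) → R) :=
  LinearMap.pi fun w => match w with
    | [] => 0
    | l :: w => B.c l ∘ₗ LinearMap.proj w

@[simp]
theorem shift_nil (f : List (Letter n r) → R) : B.shift f [] = 0 := rfl

@[simp]
theorem shift_cons (f : List (Letter n r) → R) (l : Letter n r) (w : List (Letter n r)) :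
    B.shift f (l :: w) = B.c l (f w) := rfl

variable (K r) in
/-- Left multiplication on functions on words. -/
def leftMul : R →ₐ[K] Module.End K (List (Letter n r) → R) := Algebra.lsmul K K _

@[simp]
theorem leftMul_apply (a : R) (f : List (Letter n r) → R) (w : List (Letter n r)) :
    leftMul K r a f w = a * f w := rfl

theorem leftMul_mul_shift (he : CompleteOrthogonalIdempotents e) {k : Fin (n + 1)} {a : R}
    (ha : a ∈ peirceSpace K e k k) : leftMul K r a * B.shift = B.shift * leftMul K r a := by
  refine LinearMap.ext fun f => funext fun w => ?_
  cases w with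
  | nil => simp
  | cons l w => simp [B.c_mul_of_mem he l ha]

theorem leftMul_single (a y : R) (w : List (Letter n r)) :
    leftMul K r a (Pi.single w y) = Pi.single w (a * y) := by
  ext w'
  by_cases h : w' = w
  · subst h; simp
  · simp [Pi.single_eq_of_ne h]

theorem shift_single_b (he : CompleteOrthogonalIdempotents e) (l : Letter n r)
    (w : List (Letter n r)) :
    B.shift (Pi.single w (B.b l)) = Pi.single (l :: w) (e l.1.castSucc) := by
  ext w'
  cases w' with
  | nil => rw [shift_nil, Pi.single_eq_of_ne (by simp)]
  | cons l' w' =>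
    rw [shift_cons]
    by_cases h : w' = w
    · subst h
      rw [Pi.single_eq_same, B.c_b_eq he]
      by_cases hl : l' = l
      · subst hl; simp
      · rw [if_neg hl, Pi.single_eq_of_ne (by simp [hl])]
    · rw [Pi.single_eq_of_ne h, Pi.single_eq_of_ne (by simp [h]), map_zero]

/-- `w` is a word of composable letters from `i` to `j`. -/
def IsWord (i : Fin (n + 1)) : Fin (n + 1) → List (Letter n r) → Prop
  | j, [] => j = i
  | j, l :: w => l.1.castSucc = j ∧ IsWord i l.1.succ w

/-- The product of basis elements along a word. -/
def wordElem (i : Fin (n + 1)) (w : List (Letter n r)) : R := (w.map B.b).prod * e i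

@[simp]
theorem wordElem_nil (i : Fin (n + 1)) : B.wordElem i [] = e i := by simp [wordElem]

@[simp]
theorem wordElem_cons (i : Fin (n + 1)) (l : Letter n r) (w : List (Letter n r)) :
    B.wordElem i (l :: w) = B.b l * B.wordElem i w := by simp [wordElem, mul_assoc]

theorem wordElem_mem (he : CompleteOrthogonalIdempotents e) {i j : Fin (n + 1)}
    {w : List (Letter n r)} (hw : IsWord i j w) : B.wordElem i w ∈ peirceSpace K e j i := by
  induction w generalizing j with
  | nil =>
    obtain rfl : j = i := hw
    simpa using idem_mem_peirceSpace he j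
  | cons l w ih =>
    obtain ⟨rfl, hw⟩ := hw
    rw [wordElem_cons]
    exact mul_mem_peirceSpace (B.b_mem l) (ih hw)

/-- The operators by which elements of degree zero and one are required to act on functions on
words. -/
def ActsLocally (ρ : R →ₐ[K] Module.End K (List (Letter n r) → R)) : Prop :=
  (∀ k, ∀ x ∈ peirceSpace K e k k, ρ x = leftMul K r x) ∧
  ∀ k : Fin n, ∀ x ∈ peirceSpace K e k.castSucc k.succ, ρ x = B.shift * leftMul K r x

variable {B} in
theorem ActsLocally.wordElem_apply {ρ : R →ₐ[K] Module.End K (List (Letter n r) → R)}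
    (hρ : B.ActsLocally ρ) (he : CompleteOrthogonalIdempotents e) {i j : Fin (n + 1)}
    {w : List (Letter n r)} (hw : IsWord i j w) :
    ρ (B.wordElem i w) (Pi.single [] (e i)) = Pi.single w (e j) := by
  induction w generalizing j with
  | nil =>
    obtain rfl : j = i := hw
    rw [wordElem_nil, hρ.1 j _ (idem_mem_peirceSpace he j), leftMul_single, (he.idem j).eq]
  | cons l w ih =>
    obtain ⟨rfl, hw⟩ := hw
    rw [wordElem_cons, map_mul, Module.End.mul_apply, ih hw, hρ.2 _ _ (B.b_mem l),
      Module.End.mul_apply, leftMul_single, (B.b_mem l).2, B.shift_single_b he]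

variable {B} in
theorem ActsLocally.mul_wordElem_apply {ρ : R →ₐ[K] Module.End K (List (Letter n r) → R)}
    (hρ : B.ActsLocally ρ) (he : CompleteOrthogonalIdempotents e) {i j : Fin (n + 1)}
    {w : List (Letter n r)} (hw : IsWord i j w) {a : R} (ha : a ∈ peirceSpace K e j j) :
    ρ (a * B.wordElem i w) (Pi.single [] (e i)) = Pi.single w a := by
  rw [map_mul, Module.End.mul_apply, hρ.wordElem_apply he hw, hρ.1 j a ha, leftMul_single, ha.2]

/-- The span of the left multiples of products along words from `i` to `j`. -/
def wordSpan (j i : Fin (n + 1)) : Submodule K R :=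
  Submodule.span K {x | ∃ a ∈ peirceSpace K e j j, ∃ w, IsWord i j w ∧ x = a * B.wordElem i w}

theorem wordSpan_le_peirceSpace (he : CompleteOrthogonalIdempotents e) (j i : Fin (n + 1)) :
    B.wordSpan j i ≤ peirceSpace K e j i := by
  refine Submodule.span_le.2 ?_
  rintro _ ⟨a, ha, w, hw, rfl⟩
  exact mul_mem_peirceSpace ha (B.wordElem_mem he hw)

theorem mul_mem_wordSpan_of_degree_zero {k i : Fin (n + 1)} {x z : R} (hx : x ∈ peirceSpace K e k k)
    (hz : z ∈ B.wordSpan k i) : x * z ∈ B.wordSpan k i := by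
  induction hz using Submodule.span_induction with
  | mem z hz =>
    obtain ⟨a, ha, w, hw, rfl⟩ := hz
    exact Submodule.subset_span ⟨x * a, mul_mem_peirceSpace hx ha, w, hw, (mul_assoc _ _ _).symm⟩
  | zero => rw [mul_zero]; exact zero_mem _
  | add y z _ _ hy hz => rw [mul_add]; exact add_mem hy hz
  | smul a z _ hz => rw [mul_smul_comm]; exact Submodule.smul_mem _ _ hz

theorem mul_mem_wordSpan_of_degree_one {k : Fin n} {i : Fin (n + 1)} {x z : R}
    (hx : x ∈ peirceSpace K e k.castSucc k.succ) (hz : z ∈ B.wordSpan k.succ i) :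
    x * z ∈ B.wordSpan k.castSucc i := by
  induction hz using Submodule.span_induction with
  | mem z hz =>
    obtain ⟨a, ha, w, hw, rfl⟩ := hz
    rw [← mul_assoc, B.expand k _ (mul_mem_peirceSpace hx ha), Finset.sum_mul]
    refine Submodule.sum_mem _ fun l _ => Submodule.subset_span
      ⟨B.c ⟨k, l⟩ (x * a), B.c_mem ⟨k, l⟩ _, ⟨k, l⟩ :: w, ⟨rfl, hw⟩, ?_⟩
    rw [wordElem_cons, mul_assoc]
  | zero => rw [mul_zero]; exact zero_mem _
  | add y z _ _ hy hz => rw [mul_add]; exact add_mem hy hz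
  | smul a z _ hz => rw [mul_smul_comm]; exact Submodule.smul_mem _ _ hz

theorem idem_mul_mul_mem_wordSpan (he : CompleteOrthogonalIdempotents e)
    (hgen : Algebra.adjoin K {x | IsLocal K e x} = ⊤) (x : R) {j m i : Fin (n + 1)} {z : R}
    (hz : z ∈ B.wordSpan m i) : e j * (x * z) ∈ B.wordSpan j i := by
  have hx : x ∈ Algebra.adjoin K {x | IsLocal K e x} := by rw [hgen]; trivial
  induction hx using Algebra.adjoin_induction generalizing j m z with
  | mem x hx =>
    have hz' := B.wordSpan_le_peirceSpace he _ _ hz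
    rcases hx with ⟨k, hk⟩ | ⟨k, hk⟩
    · by_cases hm : k = m
      · subst hm
        have h := B.mul_mem_wordSpan_of_degree_zero hk hz
        by_cases hj : j = k
        · subst hj
          rwa [(B.wordSpan_le_peirceSpace he _ _ h).1]
        · rw [idem_mul_eq_zero he (B.wordSpan_le_peirceSpace he _ _ h) hj]
          exact zero_mem _
      · rw [peirceSpace_mul_eq_zero he hk hz' hm, mul_zero]
        exact zero_mem _
    · by_cases hm : k.succ = m
      · subst hm
        have h := B.mul_mem_wordSpan_of_degree_one hk hz
        by_cases hj : j = k.castSucc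
        · subst hj
          rwa [(B.wordSpan_le_peirceSpace he _ _ h).1]
        · rw [idem_mul_eq_zero he (B.wordSpan_le_peirceSpace he _ _ h) hj]
          exact zero_mem _
      · rw [peirceSpace_mul_eq_zero he hk hz' hm, mul_zero]
        exact zero_mem _
  | algebraMap a =>
    have hz' := B.wordSpan_le_peirceSpace he _ _ hz
    rw [← Algebra.smul_def, mul_smul_comm]
    refine Submodule.smul_mem _ _ ?_
    by_cases hj : j = m
    · subst hj
      rwa [hz'.1]
    · rw [idem_mul_eq_zero he hz' hj]
      exact zero_mem _
  | add x y _ _ hx hy =>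
    rw [add_mul, mul_add]
    exact add_mem (hx hz) (hy hz)
  | mul x y _ _ hx hy =>
    rw [mul_assoc, mul_eq_sum_idem he x (y * z), Finset.mul_sum]
    refine Submodule.sum_mem _ fun m' _ => ?_
    rw [mul_assoc]
    exact hx (hy hz)

theorem wordSpan_eq_peirceSpace (he : CompleteOrthogonalIdempotents e)
    (hgen : Algebra.adjoin K {x | IsLocal K e x} = ⊤) (j i : Fin (n + 1)) :
    B.wordSpan j i = peirceSpace K e j i := by
  refine le_antisymm (B.wordSpan_le_peirceSpace he j i) fun x hx => ?_
  have hi : e i ∈ B.wordSpan i i :=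
    Submodule.subset_span ⟨e i, idem_mem_peirceSpace he i, [], rfl, by simp [(he.idem i).eq]⟩
  have h := B.idem_mul_mul_mem_wordSpan he hgen x (j := j) hi
  rwa [hx.2, hx.1] at h

theorem IsWord.le {i j : Fin (n + 1)} {w : List (Letter n r)} (hw : IsWord i j w) : j ≤ i := by
  induction w generalizing j with
  | nil => exact le_of_eq hw
  | cons l w ih =>
    obtain ⟨rfl, hw⟩ := hw
    exact (Fin.castSucc_lt_succ).le.trans (ih hw)

theorem IsWord.eq_nil {i : Fin (n + 1)} {w : List (Letter n r)} (hw : IsWord i i w) : w = [] := by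
  cases w with
  | nil => rfl
  | cons l w =>
    obtain ⟨h, hw⟩ := hw
    exact absurd hw.le (by rw [← h]; exact not_le.2 Fin.castSucc_lt_succ)

/-- A nonempty word is given by its first letter and a shorter word. -/
def wordEquiv {i : Fin (n + 1)} {k : Fin n} (hki : k.castSucc ≠ i) :
    {w : List (Letter n r) // IsWord i k.castSucc w} ≃
      Fin (r k) × {w : List (Letter n r) // IsWord i k.succ w} where
  toFun
    | ⟨[], h⟩ => absurd h hki
    | ⟨⟨k', l⟩ :: w, h⟩ =>
      have hk : k' = k := Fin.castSucc_injective _ h.1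
      (hk ▸ l, ⟨w, hk ▸ h.2⟩)
  invFun x := ⟨⟨k, x.1⟩ :: x.2.1, rfl, x.2.2⟩
  left_inv := by
    rintro ⟨_ | ⟨⟨k', l⟩, w⟩, h⟩
    · exact absurd h hki
    · obtain rfl : k' = k := Fin.castSucc_injective _ h.1
      rfl
  right_inv _ := rfl

theorem nonempty_fin_equiv_words (r : Fin n → ℕ) (i : Fin (n + 1)) (d : ℕ) (j : Fin (n + 1))
    (hd : (j : ℕ) + d = i) :
    Nonempty (Fin (∏ k ∈ Finset.Ico (j : ℕ) (i : ℕ), if h : k < n then r ⟨k, h⟩ else 1) ≃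
      {w : List (Letter n r) // IsWord i j w}) := by
  induction d generalizing j with
  | zero =>
    obtain rfl : j = i := Fin.ext (by simpa using hd)
    rw [Finset.Ico_self, Finset.prod_empty]
    have : Unique {w : List (Letter n r) // IsWord j j w} :=
      ⟨⟨⟨[], rfl⟩⟩, fun w => Subtype.ext w.2.eq_nil⟩
    exact ⟨Equiv.ofUnique _ _⟩
  | succ d ih =>
    obtain ⟨k, rfl⟩ : ∃ k : Fin n, j = k.castSucc := ⟨⟨j, by omega⟩, rfl⟩
    have hki : k.castSucc ≠ i := by
      rintro rfl
      omega
    obtain ⟨σ⟩ := ih k.succ (by simp at hd ⊢; omega)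
    have hprod : (∏ m ∈ Finset.Ico (k.castSucc : ℕ) (i : ℕ), if h : m < n then r ⟨m, h⟩ else 1) =
        r k * ∏ m ∈ Finset.Ico (k.succ : ℕ) (i : ℕ), if h : m < n then r ⟨m, h⟩ else 1 := by
      rw [Finset.prod_eq_prod_Ico_succ_bot (by simp at hd ⊢; omega)]
      simp
    rw [hprod]
    exact ⟨finProdFinEquiv.symm.trans
      (((Equiv.refl _).prodCongr σ).trans (wordEquiv hki).symm)⟩

end PeirceCoordinates

/-! ## The path algebra -/

section PathAlgebra

variable {K} {Q}

theorem completeOrthogonalIdempotents_vertexElem :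
    CompleteOrthogonalIdempotents (vertexElem K Q) where
  idem i := vertexElem_mul_self K Q i
  ortho i j h := by
    change vertexElem K Q i * vertexElem K Q j = 0
    rw [vertexElem, vertexElem, ← map_mul, RingQuot.mkAlgHom_rel K (PathRel.orth i j h), map_zero]
  complete := by
    simp only [vertexElem]
    rw [← map_sum, RingQuot.mkAlgHom_rel K PathRel.sum_one, map_one]

theorem arrowElem_mem (a : Q.A) :
    arrowElem K Q a ∈ peirceSpace K (vertexElem K Q) (Q.tgt a) (Q.src a) := by
  constructor
  · unfold vertexElem arrowElem
    rw [← map_mul, RingQuot.mkAlgHom_rel K (PathRel.tgt_mul a)]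
  · unfold vertexElem arrowElem
    rw [← map_mul, RingQuot.mkAlgHom_rel K (PathRel.mul_src a)]

variable (K Q) in
theorem adjoin_vertexElem_arrowElem :
    Algebra.adjoin K (Set.range (vertexElem K Q) ∪ Set.range (arrowElem K Q)) = ⊤ := by
  have h : Set.range (vertexElem K Q) ∪ Set.range (arrowElem K Q) =
      RingQuot.mkAlgHom K (PathRel K Q) '' Set.range (FreeAlgebra.ι K) := by
    rw [← Set.range_comp, ← Set.Sum.elim_range]
    congr 1
    ext (i | a) <;> rfl
  rw [h, Algebra.adjoin_image, FreeAlgebra.adjoin_range_ι, Algebra.map_top]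
  exact (AlgHom.range_eq_top _).2 (RingQuot.mkAlgHom_surjective K _)

theorem exists_pathAlgebra_lift {S : Type} [Ring S] [Algebra K S] {e : Q.V → S}
    (he : CompleteOrthogonalIdempotents e) (f : Q.A → S)
    (hf : ∀ a, f a ∈ peirceSpace K e (Q.tgt a) (Q.src a)) :
    ∃ ψ : PathAlgebra K Q →ₐ[K] S, (∀ i, ψ (vertexElem K Q i) = e i) ∧
      ∀ a, ψ (arrowElem K Q a) = f a := by
  have h : ∀ ⦃x y⦄, PathRel K Q x y →
      FreeAlgebra.lift K (Sum.elim e f) x = FreeAlgebra.lift K (Sum.elim e f) y := by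
    intro x y hxy
    induction hxy with
    | idem i => simpa using (he.idem i).eq
    | orth i j h => simpa using he.ortho h
    | sum_one => simpa using he.complete
    | tgt_mul a => simpa using (hf a).1
    | mul_src a => simpa using (hf a).2
  refine ⟨RingQuot.liftAlgHom K ⟨FreeAlgebra.lift K (Sum.elim e f), h⟩, fun i => ?_, fun a => ?_⟩
  · rw [vertexElem, RingQuot.liftAlgHom_mkAlgHom_apply]
    simp
  · rw [arrowElem, RingQuot.liftAlgHom_mkAlgHom_apply]
    simp

theorem list_prod_mem_peirceSpace (l : List Q.A) (hl : l ≠ [])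
    (hc : l.IsChain fun a b => Q.src a = Q.tgt b) :
    (l.map (arrowElem K Q)).prod ∈
      peirceSpace K (vertexElem K Q) (Q.tgt (l.head hl)) (Q.src (l.getLast hl)) := by
  induction l with
  | nil => exact absurd rfl hl
  | cons a l ih =>
    cases l with
    | nil => simpa using arrowElem_mem a
    | cons b l =>
      rw [List.isChain_cons_cons] at hc
      rw [List.map_cons, List.prod_cons, List.getLast_cons (by simp)]
      exact mul_mem_peirceSpace (arrowElem_mem a) (ih (by simp) hc.2)

theorem pathElem_mem (p : QPath Q) :
    pathElem K Q p ∈ peirceSpace K (vertexElem K Q) p.tgt p.src :=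
  list_prod_mem_peirceSpace p.arrows p.ne p.chain

theorem relElem_mem {c : QPath Q →₀ K} {i j : Q.V} (hc : IsRelationData K Q c i j) :
    relElem K Q c ∈ peirceSpace K (vertexElem K Q) i j := by
  refine Submodule.sum_mem _ fun p hp => Submodule.smul_mem _ _ ?_
  obtain ⟨-, rfl, rfl⟩ := hc p hp
  exact pathElem_mem p

variable (K Q) in
/-- The subspace of the path algebra spanned by the paths of length at least two. -/
def longPathSpan : Submodule K (PathAlgebra K Q) :=
  Submodule.span K {x | ∃ p : QPath Q, 2 ≤ p.length ∧ x = pathElem K Q p}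

theorem vertexElem_mul_pathElem_mem (i : Q.V) {p : QPath Q} (hp : 2 ≤ p.length) :
    vertexElem K Q i * pathElem K Q p ∈ longPathSpan K Q := by
  by_cases h : i = p.tgt
  · subst h
    rw [(pathElem_mem p).1]
    exact Submodule.subset_span ⟨p, hp, rfl⟩
  · rw [idem_mul_eq_zero completeOrthogonalIdempotents_vertexElem (pathElem_mem p) h]
    exact zero_mem _

theorem pathElem_mul_vertexElem_mem (i : Q.V) {p : QPath Q} (hp : 2 ≤ p.length) :
    pathElem K Q p * vertexElem K Q i ∈ longPathSpan K Q := by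
  by_cases h : p.src = i
  · subst h
    rw [(pathElem_mem p).2]
    exact Submodule.subset_span ⟨p, hp, rfl⟩
  · rw [mul_idem_eq_zero completeOrthogonalIdempotents_vertexElem (pathElem_mem p) h]
    exact zero_mem _

theorem arrowElem_mul_pathElem_mem (a : Q.A) {p : QPath Q} (hp : 2 ≤ p.length) :
    arrowElem K Q a * pathElem K Q p ∈ longPathSpan K Q := by
  by_cases h : Q.src a = p.tgt
  · refine Submodule.subset_span ⟨⟨[a] ++ p.arrows, by simp, ?_⟩, ?_, by simp [pathElem]⟩
    · refine List.isChain_append.2 ⟨by simp, p.chain, fun x hx y hy => ?_⟩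
      obtain rfl : a = x := by simpa using hx
      rw [List.head?_eq_some_head p.ne, Option.mem_some_iff] at hy
      rw [h, ← hy]
      rfl
    · exact hp.trans (by simp [QPath.length])
  · rw [peirceSpace_mul_eq_zero completeOrthogonalIdempotents_vertexElem (arrowElem_mem a)
      (pathElem_mem p) h]
    exact zero_mem _

theorem pathElem_mul_arrowElem_mem (a : Q.A) {p : QPath Q} (hp : 2 ≤ p.length) :
    pathElem K Q p * arrowElem K Q a ∈ longPathSpan K Q := by
  by_cases h : p.src = Q.tgt a
  · refine Submodule.subset_span ⟨⟨p.arrows ++ [a], by simp, ?_⟩, ?_, by simp [pathElem]⟩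
    · refine List.isChain_append.2 ⟨p.chain, by simp, fun x hx y hy => ?_⟩
      obtain rfl : a = y := by simpa using hy
      rw [List.getLast?_eq_some_getLast p.ne, Option.mem_some_iff] at hx
      rw [← h, ← hx]
      rfl
    · exact hp.trans (by simp [QPath.length])
  · rw [peirceSpace_mul_eq_zero completeOrthogonalIdempotents_vertexElem (pathElem_mem p)
      (arrowElem_mem a) h]
    exact zero_mem _

theorem mul_mem_longPathSpan (x : PathAlgebra K Q) {z : PathAlgebra K Q}
    (hz : z ∈ longPathSpan K Q) : x * z ∈ longPathSpan K Q := by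
  have hx : x ∈ Algebra.adjoin K (Set.range (vertexElem K Q) ∪ Set.range (arrowElem K Q)) := by
    rw [adjoin_vertexElem_arrowElem]; trivial
  induction hx using Algebra.adjoin_induction generalizing z with
  | mem x hx =>
    induction hz using Submodule.span_induction with
    | mem z hz =>
      obtain ⟨p, hp, rfl⟩ := hz
      rcases hx with ⟨i, rfl⟩ | ⟨a, rfl⟩
      · exact vertexElem_mul_pathElem_mem i hp
      · exact arrowElem_mul_pathElem_mem a hp
    | zero => rw [mul_zero]; exact zero_mem _
    | add y z _ _ hy hz => rw [mul_add]; exact add_mem hy hz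
    | smul a z _ hz => rw [mul_smul_comm]; exact Submodule.smul_mem _ _ hz
  | algebraMap a => rw [← Algebra.smul_def]; exact Submodule.smul_mem _ _ hz
  | add x y _ _ hx hy => rw [add_mul]; exact add_mem (hx hz) (hy hz)
  | mul x y _ _ hx hy => rw [mul_assoc]; exact hx (hy hz)

theorem mem_longPathSpan_mul (x : PathAlgebra K Q) {z : PathAlgebra K Q}
    (hz : z ∈ longPathSpan K Q) : z * x ∈ longPathSpan K Q := by
  have hx : x ∈ Algebra.adjoin K (Set.range (vertexElem K Q) ∪ Set.range (arrowElem K Q)) := by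
    rw [adjoin_vertexElem_arrowElem]; trivial
  induction hx using Algebra.adjoin_induction generalizing z with
  | mem x hx =>
    induction hz using Submodule.span_induction with
    | mem z hz =>
      obtain ⟨p, hp, rfl⟩ := hz
      rcases hx with ⟨i, rfl⟩ | ⟨a, rfl⟩
      · exact pathElem_mul_vertexElem_mem i hp
      · exact pathElem_mul_arrowElem_mem a hp
    | zero => rw [zero_mul]; exact zero_mem _
    | add y z _ _ hy hz => rw [add_mul]; exact add_mem hy hz
    | smul a z _ hz => rw [smul_mul_assoc]; exact Submodule.smul_mem _ _ hz
  | algebraMap a =>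
    rw [← Algebra.commutes, ← Algebra.smul_def]
    exact Submodule.smul_mem _ _ hz
  | add x y _ _ hx hy => rw [mul_add]; exact add_mem (hx hz) (hy hz)
  | mul x y _ _ hx hy => rw [← mul_assoc]; exact hy (hx hz)

theorem IsRelation.mem_longPathSpan {x : PathAlgebra K Q} (hx : IsRelation K Q x) :
    x ∈ longPathSpan K Q := by
  obtain ⟨c, i, j, hc, rfl⟩ := hx
  exact Submodule.sum_mem _ fun p hp =>
    Submodule.smul_mem _ _ (Submodule.subset_span ⟨p, (hc p hp).1, rfl⟩)

theorem mem_longPathSpan_of_mem_twoSidedSpan {S : Set (PathAlgebra K Q)}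
    (hS : ∀ x ∈ S, IsRelation K Q x) {x : PathAlgebra K Q}
    (hx : x ∈ twoSidedSpan (PathAlgebra K Q) S) : x ∈ longPathSpan K Q := by
  refine (AddSubgroup.closure_le (longPathSpan K Q).toAddSubgroup).2 ?_ hx
  rintro _ ⟨a, b, s, hs, rfl⟩
  exact mem_longPathSpan_mul b (mul_mem_longPathSpan a (hS s hs).mem_longPathSpan)

theorem exists_relationData_of_mem_longPathSpan {x : PathAlgebra K Q}
    (hx : x ∈ longPathSpan K Q) (j i : Q.V) :
    ∃ c : QPath Q →₀ K, IsRelationData K Q c j i ∧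
      vertexElem K Q j * x * vertexElem K Q i = relElem K Q c := by
  classical
  induction hx using Submodule.span_induction with
  | mem x hx =>
    obtain ⟨p, hp, rfl⟩ := hx
    by_cases h : p.tgt = j ∧ p.src = i
    · refine ⟨Finsupp.single p 1, fun q hq => ?_, ?_⟩
      · obtain rfl := Finset.mem_singleton.1 (Finsupp.support_single_subset hq)
        exact ⟨hp, h⟩
      · obtain ⟨rfl, rfl⟩ := h
        rw [corner_eq_of_mem (pathElem_mem p), relElem, Finsupp.sum_single_index (by simp),
          one_smul]
    · refine ⟨0, fun q hq => by simp at hq, ?_⟩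
      rw [relElem, Finsupp.sum_zero_index]
      by_cases hj : p.tgt = j
      · rw [mul_assoc, mul_idem_eq_zero completeOrthogonalIdempotents_vertexElem (pathElem_mem p)
          (fun hi => h ⟨hj, hi⟩), mul_zero]
      · rw [idem_mul_eq_zero completeOrthogonalIdempotents_vertexElem (pathElem_mem p)
          (Ne.symm hj), zero_mul]
  | zero =>
    refine ⟨0, fun q hq => by simp at hq, ?_⟩
    rw [relElem, Finsupp.sum_zero_index, mul_zero, zero_mul]
  | add x y _ _ hx hy =>
    obtain ⟨c, hc, hxc⟩ := hx
    obtain ⟨d, hd, hyd⟩ := hy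
    refine ⟨c + d, fun q hq => ?_, ?_⟩
    · rcases Finset.mem_union.1 (Finsupp.support_add hq) with h | h
      exacts [hc q h, hd q h]
    · rw [mul_add, add_mul, hxc, hyd, relElem, relElem, relElem,
        Finsupp.sum_add_index' (by simp) (by simp [add_smul])]
  | smul a x _ hx =>
    obtain ⟨c, hc, hxc⟩ := hx
    refine ⟨a • c, fun q hq => hc q (Finsupp.support_smul hq), ?_⟩
    rw [mul_smul_comm, smul_mul_assoc, hxc, relElem, relElem,
      Finsupp.sum_smul_index' (by simp), Finsupp.smul_sum]
    simp [mul_smul]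

end PathAlgebra

/-! ## Existence and uniqueness of expansions along words -/

namespace PeirceCoordinates

variable {K} {n : ℕ} {r : Fin n → ℕ} {R : Type} [Ring R] [Algebra K R] {e : Fin (n + 1) → R}
  (B : PeirceCoordinates (K := K) r e)

theorem exists_expansion (he : CompleteOrthogonalIdempotents e)
    (hgen : Algebra.adjoin K {x | IsLocal K e x} = ⊤) {i j : Fin (n + 1)} {N : ℕ}
    (σ : Fin N ≃ {w : List (Letter n r) // IsWord i j w}) {x : R} (hx : x ∈ peirceSpace K e j i) :
    ∃ a : Fin N → R, (∀ m, a m ∈ peirceSpace K e j j) ∧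
      x = ∑ m, a m * B.wordElem i (σ m).1 := by
  rw [← B.wordSpan_eq_peirceSpace he hgen] at hx
  induction hx using Submodule.span_induction with
  | mem x hx =>
    obtain ⟨a, ha, w, hw, rfl⟩ := hx
    refine ⟨Pi.single (σ.symm ⟨w, hw⟩) a, fun m => ?_, ?_⟩
    · by_cases h : m = σ.symm ⟨w, hw⟩
      · subst h; simpa using ha
      · rw [Pi.single_eq_of_ne h]; exact zero_mem _
    · rw [Finset.sum_eq_single (σ.symm ⟨w, hw⟩)]
      · simp
      · intro m _ hm
        rw [Pi.single_eq_of_ne hm, zero_mul]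
      · simp
  | zero => exact ⟨0, fun _ => zero_mem _, by simp⟩
  | add x y _ _ hx hy =>
    obtain ⟨a, ha, rfl⟩ := hx
    obtain ⟨b, hb, rfl⟩ := hy
    exact ⟨a + b, fun m => add_mem (ha m) (hb m), by simp [add_mul, Finset.sum_add_distrib]⟩
  | smul s x _ hx =>
    obtain ⟨a, ha, rfl⟩ := hx
    exact ⟨s • a, fun m => Submodule.smul_mem _ _ (ha m), by simp [Finset.smul_sum]⟩

theorem eq_zero_of_sum_eq_zero (he : CompleteOrthogonalIdempotents e)
    {ρ : R →ₐ[K] Module.End K (List (Letter n r) → R)} (hρ : B.ActsLocally ρ)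
    {i j : Fin (n + 1)} {N : ℕ} (σ : Fin N ≃ {w : List (Letter n r) // IsWord i j w})
    {a : Fin N → R} (ha : ∀ m, a m ∈ peirceSpace K e j j)
    (h : ∑ m, a m * B.wordElem i (σ m).1 = 0) (m : Fin N) : a m = 0 := by
  have h' := congrFun (congrArg (fun x => ρ x (Pi.single [] (e i))) h) (σ m).1
  simp only [map_sum, LinearMap.sum_apply, hρ.mul_wordElem_apply he (σ _).2 (ha _), map_zero,
    Finset.sum_apply] at h'
  rw [Finset.sum_eq_single m] at h'
  · simpa using h'
  · intro m' _ hm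
    refine Pi.single_eq_of_ne (fun h => hm ?_) _
    exact (σ.injective (Subtype.ext h)).symm
  · simp

/-- The extension of a locally prescribed action: an algebra map which is given by the
prescribed operators on generators is so on all elements of degree zero and one. -/
theorem actsLocally_of_generators {P : Type} [Ring P] [Algebra K P] {v : Fin (n + 1) → P}
    (hv : CompleteOrthogonalIdempotents v) (φ : P →ₐ[K] R) (hφ : ∀ k, φ (v k) = e k)
    (ψ : P →ₐ[K] Module.End K (List (Letter n r) → R)) {G : Set P}
    (hG : Algebra.adjoin K G = ⊤) (he : CompleteOrthogonalIdempotents e)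
    (hψv : ∀ k, ψ (v k) = leftMul K r (φ (v k)))
    (hψ : ∀ x ∈ G, (∃ k, x ∈ peirceSpace K v k k ∧ ψ x = leftMul K r (φ x)) ∨
      ∃ k : Fin n, x ∈ peirceSpace K v k.castSucc k.succ ∧
        ψ x = B.shift * leftMul K r (φ x)) :
    (∀ k, ∀ x ∈ peirceSpace K v k k, ψ x = leftMul K r (φ x)) ∧
    ∀ k : Fin n, ∀ x ∈ peirceSpace K v k.castSucc k.succ,
      ψ x = B.shift * leftMul K r (φ x) := by
  have hgen : Algebra.adjoin K {x | IsLocal K v x} = ⊤ := by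
    refine top_le_iff.1 (hG ▸ Algebra.adjoin_mono fun x hx => ?_)
    exact (hψ x hx).imp (fun ⟨k, hk, _⟩ => ⟨k, hk⟩) (fun ⟨k, hk, _⟩ => ⟨k, hk⟩)
  have key : ∀ x : P,
      (∀ k, ψ (v k * x * v k) = leftMul K r (φ (v k * x * v k))) ∧
      ∀ k : Fin n, ψ (v k.castSucc * x * v k.succ) =
        B.shift * leftMul K r (φ (v k.castSucc * x * v k.succ)) := by
    intro x
    have hx : x ∈ Algebra.adjoin K G := by rw [hG]; trivial
    have h0 : ∀ {j i x}, x ∈ peirceSpace K v j i → ∀ j' i', j ≠ j' ∨ i ≠ i' →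
        v j' * x * v i' = 0 := by
      rintro j i x hx j' i' (h | h)
      · rw [idem_mul_eq_zero hv hx h.symm, zero_mul]
      · rw [mul_assoc, mul_idem_eq_zero hv hx h, mul_zero]
    induction hx using Algebra.adjoin_induction with
    | mem x hx =>
      rcases hψ x hx with ⟨k, hk, hx⟩ | ⟨k, hk, hx⟩
      · refine ⟨fun m => ?_, fun m => ?_⟩
        · by_cases h : k = m
          · subst h
            rw [corner_eq_of_mem hk, hx]
          · rw [h0 hk _ _ (.inl h), map_zero, map_zero, map_zero]
        · rw [h0 hk, map_zero, map_zero, map_zero, mul_zero]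
          by_contra! h
          exact (Fin.castSucc_lt_succ (i := m)).ne (h.1.symm.trans h.2)
      · refine ⟨fun m => ?_, fun m => ?_⟩
        · rw [h0 hk, map_zero, map_zero, map_zero]
          by_contra! h
          exact (Fin.castSucc_lt_succ (i := k)).ne (h.1.trans h.2.symm)
        · by_cases h : k = m
          · subst h
            rw [corner_eq_of_mem hk, hx]
          · rw [h0 hk _ _ (.inl fun h' => h (Fin.castSucc_injective _ h')), map_zero, map_zero,
              map_zero, mul_zero]
    | algebraMap a =>
      have h1 : ∀ j i, v j * algebraMap K P a * v i = a • (v j * v i) := fun j i => by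
        rw [← Algebra.commutes, mul_assoc, ← Algebra.smul_def]
      refine ⟨fun k => ?_, fun k => ?_⟩
      · rw [h1, (hv.idem k).eq, map_smul, map_smul, map_smul, hψv]
      · rw [h1, hv.ortho (Fin.castSucc_lt_succ).ne]
        simp
    | add x y _ _ hx hy =>
      refine ⟨fun k => ?_, fun k => ?_⟩
      · simp only [mul_add, add_mul, map_add] at hx hy ⊢
        rw [hx.1, hy.1]
      · simp only [mul_add, add_mul, map_add] at hx hy ⊢
        rw [hx.2, hy.2]
    | mul x y _ _ hx hy =>
      refine ⟨fun k => ?_, fun k => ?_⟩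
      · rw [corner_mul_self hv hgen, map_mul ψ (v k * x * v k), hx.1, hy.1, ← map_mul, ← map_mul]
      · have ha : φ (v k.castSucc * x * v k.castSucc) ∈ peirceSpace K e k.castSucc k.castSucc := by
          rw [map_mul, map_mul, hφ]
          exact corner_mem_peirceSpace he _ _ _
        rw [corner_mul_succ hv hgen, map_add ψ, map_mul ψ (v k.castSucc * x * v k.castSucc),
          map_mul ψ (v k.castSucc * x * v k.succ), hx.1, hy.2, hx.2, hy.1, ← mul_assoc,
          B.leftMul_mul_shift he ha, map_add φ, map_mul φ (v k.castSucc * x * v k.castSucc),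
          map_mul φ (v k.castSucc * x * v k.succ), map_add (leftMul K r), map_mul (leftMul K r),
          map_mul (leftMul K r), mul_add, mul_assoc B.shift, mul_assoc B.shift]
  refine ⟨fun k x hx => ?_, fun k x hx => ?_⟩
  · have := (key x).1 k
    rwa [corner_eq_of_mem hx] at this
  · have := (key x).2 k
    rwa [corner_eq_of_mem hx] at this

end PeirceCoordinates

/-! ## Constructing and transferring coordinates -/

section Corner

variable {K} {n : ℕ} {r : Fin n → ℕ} {R : Type} [Ring R] [Algebra K R]

theorem CornerPiece.val_sum {ε : IdemElem R} {f : R} {α : Type} (s : Finset α)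
    (g : α → CornerPiece ε f) : (∑ x ∈ s, g x).1 = ∑ x ∈ s, (g x).1 :=
  map_sum (⟨⟨fun x : CornerPiece ε f => x.1, rfl⟩, fun _ _ => rfl⟩ : CornerPiece ε f →+ R) g s

/-- Free left modules `e_k R e_{k+1}` yield Peirce coordinates. -/
theorem nonempty_peirceCoordinates (ε : Fin (n + 1) → IdemElem R)
    (β : ∀ k : Fin n, CornerPiece (ε k.castSucc) (ε k.succ).e ≃ₗ[Corner (ε k.castSucc)]
      (Fin (r k) → Corner (ε k.castSucc))) :
    Nonempty (PeirceCoordinates (K := K) r fun k => (ε k).e) := by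
  let proj : ∀ k : Fin n, R → CornerPiece (ε k.castSucc) (ε k.succ).e := fun k y =>
    ⟨(ε k.castSucc).e * y * (ε k.succ).e,
      by rw [← mul_assoc, ← mul_assoc, (ε k.castSucc).idem],
      by rw [mul_assoc, (ε k.succ).idem]⟩
  let scal : ∀ k : Fin n, K → Corner (ε k.castSucc) := fun k s =>
    ⟨s • (ε k.castSucc).e, by rw [mul_smul_comm, (ε k.castSucc).idem],
      by rw [smul_mul_assoc, (ε k.castSucc).idem]⟩
  have proj_val : ∀ k (y : CornerPiece (ε k.castSucc) (ε k.succ).e), proj k y.1 = y :=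
    fun k y => Subtype.ext (by simp only [proj]; rw [y.2.1, y.2.2])
  have proj_add : ∀ k x y, proj k (x + y) = proj k x + proj k y := fun k x y =>
    Subtype.ext (by
      change (ε k.castSucc).e * (x + y) * (ε k.succ).e =
        (ε k.castSucc).e * x * (ε k.succ).e + (ε k.castSucc).e * y * (ε k.succ).e
      rw [mul_add, add_mul])
  have proj_smul : ∀ k s y, proj k (s • y) = scal k s • proj k y := fun k s y => Subtype.ext (by
    change (ε k.castSucc).e * (s • y) * (ε k.succ).e =
      s • (ε k.castSucc).e * ((ε k.castSucc).e * y * (ε k.succ).e)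
    rw [smul_mul_assoc s, ← mul_assoc, ← mul_assoc, (ε k.castSucc).idem, mul_smul_comm,
      smul_mul_assoc])
  have proj_mul : ∀ k (a : Corner (ε k.castSucc)) y, proj k (a.1 * y) = a • proj k y :=
    fun k a y => Subtype.ext (by
      change (ε k.castSucc).e * (a.1 * y) * (ε k.succ).e =
        a.1 * ((ε k.castSucc).e * y * (ε k.succ).e)
      rw [← mul_assoc, a.2.1, ← mul_assoc, ← mul_assoc, a.2.2])
  exact ⟨{
    b := fun l => ((β l.1).symm (Pi.single l.2 1)).1
    c := fun l =>
      { toFun := fun y => (β l.1 (proj l.1 y) l.2).1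
        map_add' := fun x y => by
          rw [proj_add, map_add]
          rfl
        map_smul' := fun s y => by
          rw [proj_smul, map_smul]
          change s • (ε l.1.castSucc).e * (β l.1 (proj l.1 y) l.2).1 = _
          rw [smul_mul_assoc, (β l.1 (proj l.1 y) l.2).2.1]
          rfl }
    b_mem := fun l => ((β l.1).symm (Pi.single l.2 1)).2
    c_mem := fun l y => (β l.1 (proj l.1 y) l.2).2
    c_mul := fun l a ha y => by
      change (β l.1 (proj l.1 (a * y)) l.2).1 = a * (β l.1 (proj l.1 y) l.2).1
      let a' : Corner (ε l.1.castSucc) := ⟨a, ha⟩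
      rw [show proj l.1 (a * y) = a' • proj l.1 y from proj_mul l.1 a' y, map_smul]
      rfl
    c_proj := fun l y => by
      change (β l.1 (proj l.1 (proj l.1 y).1) l.2).1 = (β l.1 (proj l.1 y) l.2).1
      rw [proj_val]
    expand := fun k y hy => by
      change y = ∑ l : Fin (r k), (β k (proj k y) l).1 * ((β k).symm (Pi.single l 1)).1
      have hsum : β k (proj k y) = ∑ l, β k (proj k y) l • Pi.single l 1 := by
        ext m : 1
        simp [Finset.sum_apply, Pi.single_apply]
      have h := congrArg Subtype.val (congrArg (β k).symm hsum)
      rw [LinearEquiv.symm_apply_apply, map_sum, CornerPiece.val_sum] at h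
      change (ε k.castSucc).e * y * (ε k.succ).e = _ at h
      rw [hy.1, hy.2] at h
      refine h.trans (Finset.sum_congr rfl fun l _ => ?_)
      rw [map_smul, CornerPiece.val_smul]
    c_b := fun k l l' => by
      change (β k (proj k ((β k).symm (Pi.single l' 1)).1) l).1 = _
      rw [proj_val, LinearEquiv.apply_symm_apply]
      by_cases h : l = l'
      · subst h
        rw [Pi.single_eq_same, if_pos rfl]
        rfl
      · rw [Pi.single_eq_of_ne h, if_neg h]
        rfl }⟩

/-- Peirce coordinates lift along algebra maps which are bijective on the pieces of degree zero
and one. -/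
theorem PeirceCoordinates.nonempty_of_algHom {S : Type} [Ring S] [Algebra K S] (π : S →ₐ[K] R)
    (hπ : Function.Surjective π) {e' : Fin (n + 1) → S} (he' : CompleteOrthogonalIdempotents e')
    {e : Fin (n + 1) → R} (hee : ∀ k, π (e' k) = e k)
    (hinj : ∀ x, IsLocal K e' x → π x = 0 → x = 0) (B : PeirceCoordinates (K := K) r e) :
    Nonempty (PeirceCoordinates (K := K) r e') := by
  have hmap : ∀ {j i x}, x ∈ peirceSpace K e' j i → π x ∈ peirceSpace K e j i := by
    rintro j i x ⟨h1, h2⟩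
    exact ⟨by rw [← hee, ← map_mul, h1], by rw [← hee, ← map_mul, h2]⟩
  have hlift : ∀ {j i x}, x ∈ peirceSpace K e j i → ∃ y ∈ peirceSpace K e' j i, π y = x := by
    intro j i x hx
    obtain ⟨y, rfl⟩ := hπ x
    refine ⟨e' j * y * e' i, corner_mem_peirceSpace he' j i y, ?_⟩
    rw [map_mul, map_mul, hee, hee, corner_eq_of_mem hx]
  have hext0 : ∀ {k x y}, x ∈ peirceSpace K e' k k → y ∈ peirceSpace K e' k k →
      π x = π y → x = y := fun {k x y} hx hy h =>
    sub_eq_zero.1 (hinj _ (.inl ⟨k, sub_mem hx hy⟩) (by rw [map_sub, h, sub_self]))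
  have hext1 : ∀ {k : Fin n} {x y}, x ∈ peirceSpace K e' k.castSucc k.succ →
      y ∈ peirceSpace K e' k.castSucc k.succ → π x = π y → x = y := fun {k x y} hx hy h =>
    sub_eq_zero.1 (hinj _ (.inr ⟨k, sub_mem hx hy⟩) (by rw [map_sub, h, sub_self]))
  choose b hb hπb using fun l => hlift (B.b_mem l)
  choose c hc hπc using fun l y => hlift (B.c_mem l (π y))
  exact ⟨{
    b := b
    c := fun l =>
      { toFun := c l
        map_add' := fun x y => hext0 (hc _ _) (add_mem (hc _ _) (hc _ _)) (by
          rw [map_add, hπc, hπc, hπc, map_add, map_add])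
        map_smul' := fun s y => hext0 (hc _ _) (Submodule.smul_mem _ _ (hc _ _)) (by
          rw [map_smul, RingHom.id_apply, hπc, hπc, map_smul, map_smul]) }
    b_mem := hb
    c_mem := hc
    c_mul := fun l a ha y => hext0 (hc _ _) (mul_mem_peirceSpace ha (hc _ _)) (by
      change π (c l (a * y)) = π (a * c l y)
      rw [map_mul, hπc, hπc, map_mul, B.c_mul l _ (hmap ha)])
    c_proj := fun l y => hext0 (hc _ _) (hc _ _) (by
      change π (c l _) = π (c l y)
      rw [hπc, hπc, map_mul π, map_mul π, hee, hee, B.c_proj])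
    expand := fun k y hy => hext1 hy
      (Submodule.sum_mem _ fun l _ => mul_mem_peirceSpace (hc ⟨k, l⟩ y) (hb ⟨k, l⟩)) (by
        change π y = π (∑ l, c ⟨k, l⟩ y * b ⟨k, l⟩)
        rw [map_sum]
        simp only [map_mul, hπc, hπb]
        exact B.expand k _ (hmap hy))
    c_b := fun k l l' => by
      have h0 : (if l = l' then e' k.castSucc else 0) ∈
          peirceSpace K e' k.castSucc k.castSucc := by
        split_ifs
        exacts [idem_mem_peirceSpace he' _, zero_mem _]
      refine hext0 (hc _ _) h0 ?_
      change π (c ⟨k, l⟩ (b ⟨k, l'⟩)) = _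
      rw [hπc, hπb, B.c_b]
      split_ifs
      exacts [(hee _).symm, (map_zero π).symm] }⟩

/-- The pieces `e_j R e_i` are free over `e_j R e_j`, with one basis element for each word from
`i` to `j`. -/
theorem PeirceCoordinates.nonempty_linearEquiv (ε : Fin (n + 1) → IdemElem R)
    (he : CompleteOrthogonalIdempotents fun k => (ε k).e)
    (hgen : Algebra.adjoin K {x | IsLocal K (fun k => (ε k).e) x} = ⊤)
    (B : PeirceCoordinates (K := K) r fun k => (ε k).e)
    {ρ : R →ₐ[K] Module.End K (List (Letter n r) → R)} (hρ : B.ActsLocally ρ)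
    {i j : Fin (n + 1)} {N : ℕ} (σ : Fin N ≃ {w : List (Letter n r) // IsWord i j w}) :
    Nonempty (CornerPiece (ε j) (ε i).e ≃ₗ[Corner (ε j)] (Fin N → Corner (ε j))) := by
  let F : (Fin N → Corner (ε j)) →ₗ[Corner (ε j)] CornerPiece (ε j) (ε i).e :=
    { toFun := fun a => ⟨∑ m, (a m).1 * B.wordElem i (σ m).1,
        (Submodule.sum_mem (peirceSpace K _ j i) fun m _ =>
          mul_mem_peirceSpace (a m).2 (B.wordElem_mem he (σ m).2) :)⟩
      map_add' := fun a b => Subtype.ext (by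
        change ∑ m, ((a m).1 + (b m).1) * B.wordElem i (σ m).1 = ∑ m, (a m).1 * B.wordElem i (σ m).1 + ∑ m, (b m).1 * B.wordElem i (σ m).1
        rw [← Finset.sum_add_distrib]
        exact Finset.sum_congr rfl fun m _ => add_mul _ _ _)
      map_smul' := fun s a => Subtype.ext (by
        change ∑ m, s.1 * (a m).1 * B.wordElem i (σ m).1 = s.1 * ∑ m, (a m).1 * B.wordElem i (σ m).1
        rw [Finset.mul_sum]
        exact Finset.sum_congr rfl fun m _ => mul_assoc _ _ _) }
  refine ⟨(LinearEquiv.ofBijective F ⟨(injective_iff_map_eq_zero F).2 fun a ha => ?_,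
    fun x => ?_⟩).symm⟩
  · exact funext fun m => Subtype.ext
      (B.eq_zero_of_sum_eq_zero he hρ σ (fun m => (a m).2) (congrArg Subtype.val ha) m)
  · obtain ⟨a, ha, hx⟩ := B.exists_expansion he hgen σ (x := x.1) x.2
    exact ⟨fun m => ⟨a m, ha m⟩, Subtype.ext hx.symm⟩

end Corner

/-! ## Quotients of the path algebra of a linear quiver -/

section TwoSidedSpan

variable {P : Type} [Ring P]

theorem subset_twoSidedSpan (S : Set P) : S ⊆ twoSidedSpan P S := fun s hs =>
  AddSubgroup.subset_closure ⟨1, 1, s, hs, by rw [one_mul, mul_one]⟩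

theorem map_eq_zero_of_mem_twoSidedSpan {R F : Type} [Ring R] [FunLike F P R]
    [RingHomClass F P R] (f : F) {S : Set P} (hS : ∀ s ∈ S, f s = 0) {x : P}
    (hx : x ∈ twoSidedSpan P S) : f x = 0 := by
  refine (AddSubgroup.closure_le (f : P →+ R).ker).2 ?_ hx
  rintro _ ⟨a, b, s, hs, rfl⟩
  change f (a * s * b) = 0
  rw [map_mul, map_mul, hS s hs, mul_zero, zero_mul]

/-- An algebra map vanishing on the kernel of a surjective one factors through it. -/
theorem exists_algHom_of_surjective {K P R S : Type} [Field K] [Ring P] [Ring R] [Ring S]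
    [Algebra K P] [Algebra K R] [Algebra K S] (f : P →ₐ[K] R) (hf : Function.Surjective f)
    (g : P →ₐ[K] S) (h : ∀ x, f x = 0 → g x = 0) : ∃ ρ : R →ₐ[K] S, ∀ x, ρ (f x) = g x := by
  have key : ∀ x y, f x = f y → g x = g y := fun x y hxy =>
    sub_eq_zero.1 (by rw [← map_sub]; exact h _ (by rw [map_sub, hxy, sub_self]))
  have hs := Function.surjInv_eq hf
  refine ⟨AlgHom.ofLinearMap
    { toFun := fun y => g (Function.surjInv hf y)
      map_add' := fun x y => by
        rw [← map_add]
        exact key _ _ (by rw [map_add, hs, hs, hs])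
      map_smul' := fun a x => by
        rw [RingHom.id_apply, ← map_smul]
        exact key _ _ (by rw [map_smul, hs, hs]) } ?_ fun x y => ?_, fun x => key _ _ (hs _)⟩
  · exact (key _ 1 (by rw [hs, map_one])).trans (map_one g)
  · exact (key _ (Function.surjInv hf x * Function.surjInv hf y)
      (by rw [map_mul, hs, hs, hs])).trans (map_mul g _ _)

end TwoSidedSpan

section LinearQuiver

variable {K} {n : ℕ} {t : Fin n → ℕ}

theorem val_src_getLast_eq (l : List (LinearQuiver n t).A) (hl : l ≠ [])
    (hc : l.IsChain fun a b => (LinearQuiver n t).src a = (LinearQuiver n t).tgt b) :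
    Fin.val (n := n + 1) ((LinearQuiver n t).src (l.getLast hl)) =
      Fin.val (n := n + 1) ((LinearQuiver n t).tgt (l.head hl)) +
        l.countP fun a => a.isRight := by
  have h1 : ∀ a : (LinearQuiver n t).A, Fin.val (n := n + 1) ((LinearQuiver n t).src a) =
      Fin.val (n := n + 1) ((LinearQuiver n t).tgt a) + if a.isRight then 1 else 0 := by
    rintro (k | k) <;> rfl
  induction l with
  | nil => exact absurd rfl hl
  | cons a l ih =>
    cases l with
    | nil => simpa [List.countP_cons] using h1 a
    | cons b l =>
      have hab := (List.isChain_cons_cons.1 hc).1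
      have ih := ih (by simp) (List.isChain_cons_cons.1 hc).2
      rw [List.getLast_cons (by simp), ih, List.countP_cons (a := a), List.head_cons, List.head_cons,
        ← hab, h1 a]
      omega

theorem QPath.val_src_eq (p : QPath (LinearQuiver n t)) :
    Fin.val (n := n + 1) p.src = Fin.val (n := n + 1) p.tgt + pathDegree p :=
  val_src_getLast_eq p.arrows p.ne p.chain

variable (K t) in
/-- The idempotents of the path algebra of the linear quiver. -/
abbrev linearVertex (k : Fin (n + 1)) : PathAlgebra K (LinearQuiver n t) :=
  vertexElem K (LinearQuiver n t) k

theorem completeOrthogonalIdempotents_linearVertex :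
    CompleteOrthogonalIdempotents (linearVertex K t) :=
  completeOrthogonalIdempotents_vertexElem (K := K) (Q := LinearQuiver n t)

theorem isLocal_arrowElem (a : (LinearQuiver n t).A) :
    IsLocal K (linearVertex K t) (arrowElem K (LinearQuiver n t) a) :=
  match a with
  | Sum.inl k => .inl ⟨k, arrowElem_mem (Q := LinearQuiver n t) (Sum.inl k)⟩
  | Sum.inr k => .inr ⟨k.1, arrowElem_mem (Q := LinearQuiver n t) (Sum.inr k)⟩

theorem IsDegreeLeOneRelation.isLocal {x : PathAlgebra K (LinearQuiver n t)}
    (hx : IsDegreeLeOneRelation K x) : IsLocal K (linearVertex K t) x := by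
  obtain ⟨c, i, j, hc, hdeg, rfl⟩ := hx
  by_cases h : c.support = ∅
  · rw [Finsupp.support_eq_empty.1 h]
    exact .inl ⟨0, by rw [relElem, Finsupp.sum_zero_index]; exact zero_mem _⟩
  obtain ⟨p, hp⟩ := Finset.nonempty_iff_ne_empty.2 h
  have hmem : relElem K (LinearQuiver n t) c ∈ peirceSpace K (linearVertex K t) i j :=
    relElem_mem hc
  obtain ⟨-, h1, h2⟩ := hc p hp
  have h3 := p.val_src_eq
  rw [h1, h2] at h3
  have h4 := hdeg p hp
  rcases Nat.le_one_iff_eq_zero_or_eq_one.1 h4 with h5 | h5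
  · obtain rfl : j = i := Fin.ext (by omega)
    exact .inl ⟨j, hmem⟩
  · have hi : (i : ℕ) < n := by omega
    obtain rfl : j = Fin.succ ⟨i, hi⟩ := Fin.ext (h3.trans (by rw [h5]; rfl))
    exact .inr ⟨⟨i, hi⟩, hmem⟩

variable {A : Type} [Ring A] [Algebra K A] (φ : PathAlgebra K (LinearQuiver n t) →ₐ[K] A)

theorem map_mem_peirceSpace {j i : Fin (n + 1)} {x : PathAlgebra K (LinearQuiver n t)}
    (hx : x ∈ peirceSpace K (linearVertex K t) j i) :
    φ x ∈ peirceSpace K (fun k => φ (linearVertex K t k)) j i :=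
  ⟨by rw [← map_mul, hx.1], by rw [← map_mul, hx.2]⟩

variable {φ} in
theorem exists_mem_peirceSpace_map_eq (hφ : Function.Surjective φ) {j i : Fin (n + 1)} {x : A}
    (hx : x ∈ peirceSpace K (fun k => φ (linearVertex K t k)) j i) :
    ∃ y ∈ peirceSpace K (linearVertex K t) j i, φ y = x := by
  obtain ⟨y, rfl⟩ := hφ x
  refine ⟨_, corner_mem_peirceSpace completeOrthogonalIdempotents_linearVertex j i y, ?_⟩
  rw [map_mul, map_mul]
  exact corner_eq_of_mem hx

theorem completeOrthogonalIdempotents_map :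
    CompleteOrthogonalIdempotents fun k => φ (linearVertex K t k) :=
  completeOrthogonalIdempotents_linearVertex.map φ.toRingHom

variable {φ} in
theorem adjoin_isLocal (hφ : Function.Surjective φ) :
    Algebra.adjoin K {x | IsLocal K (fun k => φ (linearVertex K t k)) x} = ⊤ := by
  rw [← top_le_iff, ← AlgHom.range_eq_top φ |>.2 hφ, ← Algebra.map_top,
    ← adjoin_vertexElem_arrowElem, ← Algebra.adjoin_image]
  refine Algebra.adjoin_mono ?_
  rintro _ ⟨x, ⟨k, rfl⟩ | ⟨a, rfl⟩, rfl⟩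
  · exact .inl ⟨k, idem_mem_peirceSpace (completeOrthogonalIdempotents_map φ) k⟩
  · exact (isLocal_arrowElem a).imp (fun ⟨k, hk⟩ => ⟨k, map_mem_peirceSpace φ hk⟩)
      fun ⟨k, hk⟩ => ⟨k, map_mem_peirceSpace φ hk⟩

/-- An element of degree zero or one in an admissible ideal is a relation of degree at most one. -/
theorem isDegreeLeOneRelation_of_isLocal (hφ : IsAdmissiblePresentation K (LinearQuiver n t) φ)
    {x : PathAlgebra K (LinearQuiver n t)} (hx : IsLocal K (linearVertex K t) x)
    (h0 : φ x = 0) : IsDegreeLeOneRelation K x := by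
  obtain ⟨-, ⟨S, hS, hker⟩, -⟩ := hφ
  have hlong : x ∈ longPathSpan K (LinearQuiver n t) := by
    refine mem_longPathSpan_of_mem_twoSidedSpan hS ?_
    rw [hker]
    exact h0
  have key : ∀ j i : Fin (n + 1), (i : ℕ) ≤ j + 1 → x ∈ peirceSpace K (linearVertex K t) j i →
      IsDegreeLeOneRelation K x := by
    intro j i hij hx
    obtain ⟨c, hc, hxc⟩ := exists_relationData_of_mem_longPathSpan hlong j i
    refine ⟨c, j, i, hc, fun p hp => ?_, (corner_eq_of_mem hx).symm.trans hxc⟩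
    obtain ⟨-, h1, h2⟩ := hc p hp
    have h3 := p.val_src_eq
    rw [h1, h2] at h3
    omega
  rcases hx with ⟨k, hk⟩ | ⟨k, hk⟩
  · exact key k k (Nat.le_succ _) hk
  · exact key _ _ le_rfl hk

/-- The operator by which an arrow acts on functions on words. -/
def arrowOperator {r : Fin n → ℕ} (B : PeirceCoordinates (K := K) r fun k => φ (linearVertex K t k)) :
    Fin (n + 1) ⊕ ((i : Fin n) × Fin (t i)) → Module.End K (List (Letter n r) → A)
  | Sum.inl k => PeirceCoordinates.leftMul K r (φ (arrowElem K (LinearQuiver n t) (Sum.inl k)))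
  | Sum.inr k => B.shift *
      PeirceCoordinates.leftMul K r (φ (arrowElem K (LinearQuiver n t) (Sum.inr k)))

theorem arrowOperator_mem {r : Fin n → ℕ}
    (B : PeirceCoordinates (K := K) r fun k => φ (linearVertex K t k))
    (a : (LinearQuiver n t).A) :
    arrowOperator φ B a ∈ peirceSpace K
      (fun k : (LinearQuiver n t).V => PeirceCoordinates.leftMul K r (φ (linearVertex K t k)))
      ((LinearQuiver n t).tgt a) ((LinearQuiver n t).src a) := by
  have he := completeOrthogonalIdempotents_map φ
  have ha := map_mem_peirceSpace φ (arrowElem_mem (Q := LinearQuiver n t) a)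
  have hl := (map_mul (PeirceCoordinates.leftMul K r (R := A)) _ _).symm.trans
    (congrArg (PeirceCoordinates.leftMul K r) ha.1)
  have hr := (map_mul (PeirceCoordinates.leftMul K r (R := A)) _ _).symm.trans
    (congrArg (PeirceCoordinates.leftMul K r) ha.2)
  rcases a with k | k
  · exact ⟨hl, hr⟩
  · refine ⟨?_, (mul_assoc _ _ _).trans (congrArg _ hr)⟩
    have hs := B.leftMul_mul_shift he (idem_mem_peirceSpace he k.1.castSucc)
    exact (mul_assoc _ _ _).symm.trans ((congrArg (· * _) hs).trans
      ((mul_assoc _ _ _).trans (congrArg _ hl)))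

theorem exists_pathAlgebra_action {r : Fin n → ℕ}
    (B : PeirceCoordinates (K := K) r fun k => φ (linearVertex K t k)) :
    ∃ ψ : PathAlgebra K (LinearQuiver n t) →ₐ[K] Module.End K (List (Letter n r) → A),
      (∀ k, ∀ x ∈ peirceSpace K (linearVertex K t) k k,
        ψ x = PeirceCoordinates.leftMul K r (φ x)) ∧
      ∀ k : Fin n, ∀ x ∈ peirceSpace K (linearVertex K t) k.castSucc k.succ,
        ψ x = B.shift * PeirceCoordinates.leftMul K r (φ x) := by
  have he := completeOrthogonalIdempotents_map φ
  obtain ⟨ψ, hψv, hψa⟩ := exists_pathAlgebra_lift (Q := LinearQuiver n t)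
    (he.map (PeirceCoordinates.leftMul K r (R := A)).toRingHom) (arrowOperator φ B)
    (arrowOperator_mem φ B)
  refine ⟨ψ, B.actsLocally_of_generators completeOrthogonalIdempotents_linearVertex φ
    (fun _ => rfl) ψ (adjoin_vertexElem_arrowElem K (LinearQuiver n t)) he hψv ?_⟩
  rintro _ (⟨k, rfl⟩ | ⟨a, rfl⟩)
  · exact .inl ⟨k, idem_mem_peirceSpace completeOrthogonalIdempotents_linearVertex k, hψv k⟩
  · rcases a with k | k
    · exact .inl ⟨k, arrowElem_mem (Q := LinearQuiver n t) (Sum.inl k), hψa _⟩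
    · exact .inr ⟨k.1, arrowElem_mem (Q := LinearQuiver n t) (Sum.inr k), hψa _⟩

/-- If the kernel of a presentation is generated by elements of degree zero and one, then the
algebra acts on the functions on words. -/
theorem exists_actsLocally (hφ : Function.Surjective φ)
    {G : Set (PathAlgebra K (LinearQuiver n t))} (hG : ∀ x ∈ G, IsLocal K (linearVertex K t) x)
    (hker : {x | φ x = 0} = twoSidedSpan (PathAlgebra K (LinearQuiver n t)) G) {r : Fin n → ℕ}
    (B : PeirceCoordinates (K := K) r fun k => φ (linearVertex K t k)) :
    ∃ ρ : A →ₐ[K] Module.End K (List (Letter n r) → A), B.ActsLocally ρ := by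
  obtain ⟨ψ, hψ0, hψ1⟩ := exists_pathAlgebra_action φ B
  have hle : ∀ x, φ x = 0 → ψ x = 0 := by
    intro x hx
    refine map_eq_zero_of_mem_twoSidedSpan ψ (fun s hs => ?_) (hker.subset hx)
    have hs0 : φ s = 0 := hker.superset (subset_twoSidedSpan G hs)
    rcases hG s hs with ⟨k, hk⟩ | ⟨k, hk⟩
    · rw [hψ0 k s hk, hs0, map_zero]
    · rw [hψ1 k s hk, hs0, map_zero, mul_zero]
  obtain ⟨ρ, hρ⟩ := exists_algHom_of_surjective φ hφ ψ hle
  refine ⟨ρ, fun k x hx => ?_, fun k x hx => ?_⟩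
  · obtain ⟨y, hy, rfl⟩ := exists_mem_peirceSpace_map_eq hφ hx
    rw [hρ, hψ0 k y hy]
  · obtain ⟨y, hy, rfl⟩ := exists_mem_peirceSpace_map_eq hφ hx
    rw [hρ, hψ1 k y hy]

end LinearQuiver

/-- Let `Q = Q(n, t₁, …, tₙ)` be the linear quiver, `A = KQ/I` with `I`
admissible, `A` geometrically irreducible.  Let `rᵢ` be the rank of the free left
`A_{i-1} = e_{i-1}Ae_{i-1}`-module `B_i = e_{i-1}Ae_i`, and let `A' = KQ/I'` where `I'`
is generated by the relations of `I` of degree at most one.  Then for all vertices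
`j ≤ i` the `A_j`-module `e_j A' e_i` is free of rank `r_{j+1} ⋯ r_i` (rank `1` for
`j = i`), and `e_j A' e_i = 0` for `j > i`; i.e. each projective `A'`-module `A'eᵢ` is
locally free with rank vector `(r₁⋯rᵢ, r₂⋯rᵢ, …, rᵢ, 1, 0, …, 0)`. -/
theorem projective_modules_locally_free_with_rank_vector [IsAlgClosed K]
    (n : ℕ) (hn : 1 ≤ n) (t : Fin n → ℕ) (ht : ∀ i, 1 ≤ t i)
    (A : Type) [Ring A] [Algebra K A] [Module.Finite K A]
    (φ : PathAlgebra K (LinearQuiver n t) →ₐ[K] A)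
    (hadm : IsAdmissiblePresentation K (LinearQuiver n t) φ)
    (hirr : IsGeomIrreducible K (LinearQuiver n t) φ)
    (r : Fin n → ℕ)
    (hr : ∀ i : Fin n,
      Nonempty (CornerPiece (vertexIdem K (LinearQuiver n t) φ i.castSucc)
          (φ (vertexElem K (LinearQuiver n t) i.succ))
        ≃ₗ[Corner (vertexIdem K (LinearQuiver n t) φ i.castSucc)]
          (Fin (r i) → Corner (vertexIdem K (LinearQuiver n t) φ i.castSucc))))
    (A' : Type) [Ring A'] [Algebra K A']
    (φ' : PathAlgebra K (LinearQuiver n t) →ₐ[K] A')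
    (hsurj' : Function.Surjective φ')
    (hker' : {x | φ' x = 0} = twoSidedSpan (PathAlgebra K (LinearQuiver n t))
      {x | IsDegreeLeOneRelation K x ∧ φ x = 0}) :
    ∀ i j : Fin (n + 1),
      (j ≤ i → Nonempty (CornerPiece (vertexIdem K (LinearQuiver n t) φ' j)
          (φ' (vertexElem K (LinearQuiver n t) i))
        ≃ₗ[Corner (vertexIdem K (LinearQuiver n t) φ' j)]
          (Fin (∏ k ∈ Finset.Ico (j : ℕ) (i : ℕ), if h : k < n then r ⟨k, h⟩ else 1) →
            Corner (vertexIdem K (LinearQuiver n t) φ' j)))) ∧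
      (i < j → Subsingleton (CornerPiece (vertexIdem K (LinearQuiver n t) φ' j)
          (φ' (vertexElem K (LinearQuiver n t) i)))) := by
  have hsurj := hadm.1
  have hG : ∀ x ∈ {x : PathAlgebra K (LinearQuiver n t) | IsDegreeLeOneRelation K x ∧ φ x = 0},
      IsLocal K (linearVertex K t) x := fun x hx => hx.1.isLocal
  have he' := completeOrthogonalIdempotents_map φ'
  have hgen' := adjoin_isLocal hsurj'
  obtain ⟨π, hπ⟩ := exists_algHom_of_surjective φ' hsurj' φ fun x hx =>
    map_eq_zero_of_mem_twoSidedSpan φ (fun _ hs => hs.2) (hker'.subset hx)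
  have hinj : ∀ x, IsLocal K (fun k => φ' (linearVertex K t k)) x → π x = 0 → x = 0 := by
    intro x hx h0
    obtain ⟨y, hy, rfl⟩ : ∃ y, IsLocal K (linearVertex K t) y ∧ φ' y = x := by
      rcases hx with ⟨k, hk⟩ | ⟨k, hk⟩
      · obtain ⟨y, hy, h⟩ := exists_mem_peirceSpace_map_eq hsurj' hk
        exact ⟨y, .inl ⟨k, hy⟩, h⟩
      · obtain ⟨y, hy, h⟩ := exists_mem_peirceSpace_map_eq hsurj' hk
        exact ⟨y, .inr ⟨k, hy⟩, h⟩
    rw [hπ] at h0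
    exact hker'.superset (subset_twoSidedSpan _ ⟨isDegreeLeOneRelation_of_isLocal φ hadm hy h0, h0⟩)
  obtain ⟨B⟩ := nonempty_peirceCoordinates (K := K)
    (fun k : Fin (n + 1) => vertexIdem K (LinearQuiver n t) φ k) fun k => (hr k).some
  have hπ_surj : Function.Surjective π := fun x => by
    obtain ⟨y, rfl⟩ := hsurj x
    exact ⟨φ' y, hπ y⟩
  obtain ⟨B'⟩ := PeirceCoordinates.nonempty_of_algHom π hπ_surj he' (fun k => hπ _) hinj B
  obtain ⟨ρ, hρ⟩ := exists_actsLocally φ' hsurj' hG hker' B'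
  intro i j
  refine ⟨fun hij => ?_, fun hij => ⟨fun x y => ?_⟩⟩
  · obtain ⟨σ⟩ := PeirceCoordinates.nonempty_fin_equiv_words r i (i - j) j (by omega)
    exact PeirceCoordinates.nonempty_linearEquiv
      (fun k : Fin (n + 1) => vertexIdem K (LinearQuiver n t) φ' k) he' hgen' B' hρ σ
  · have h0 : ∀ z : CornerPiece (vertexIdem K (LinearQuiver n t) φ' j)
        (φ' (vertexElem K (LinearQuiver n t) i)), z.1 = 0 := fun z =>
      (corner_eq_of_mem (K := K) (e := fun k => φ' (linearVertex K t k)) z.2).symm.trans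
        (corner_eq_zero_of_lt he' hgen' hij z.1)
    exact Subtype.ext ((h0 x).trans (h0 y).symm)
end
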